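/- For every S ⊆ I, the canonical basis vector b_S is invariant under the bar map: bar(b_S) = b_S. -/

import Mathlib

noncomputable section

/-- The ring `A = ℤ[q,q⁻¹]` of integer Laurent polynomials. -/
abbrev AL : Type := LaurentPolynomial ℤ

/-- The quantum parameter `q ∈ A`. -/
def qA : AL := LaurentPolynomial.T 1

/-- `q⁻¹ ∈ A`. -/
def qAinv : AL := LaurentPolynomial.T (-1)

/-- The index set `I = {1,…,n} ∪ {−n,…,−1}` as a finset of integers. -/
def Iset (n : ℕ) : Finset ℤ := (Finset.Icc (-(n : ℤ)) (n : ℤ)).erase 0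

/-- The type of generators, indexed by `I`. -/
abbrev Gen (n : ℕ) : Type := {x : ℤ // x ∈ Iset n}

/-- The generator of the free algebra indexed by `x ∈ I` (junk value `0` otherwise). -/
def gn (n : ℕ) (x : ℤ) : FreeAlgebra AL (Gen n) :=
  if h : x ∈ Iset n then FreeAlgebra.ι AL (⟨x, h⟩ : Gen n) else 0

/-- The defining relations of the quantum exterior algebra of type C. -/
inductive CRel (n : ℕ) : FreeAlgebra AL (Gen n) → FreeAlgebra AL (Gen n) → Prop
  | sq (x : ℤ) (hx : x ∈ Iset n) : CRel n (gn n x * gn n x) 0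
  | posSwap (i j : ℕ) (h1 : 1 ≤ i) (h2 : i < j) (h3 : j ≤ n) :
      CRel n (gn n (j : ℤ) * gn n (i : ℤ)) ((-qA) • (gn n (i : ℤ) * gn n (j : ℤ)))
  | negSwap (i j : ℕ) (h1 : 1 ≤ i) (h2 : i < j) (h3 : j ≤ n) :
      CRel n (gn n (-(i : ℤ)) * gn n (-(j : ℤ))) ((-qA) • (gn n (-(j : ℤ)) * gn n (-(i : ℤ))))
  | mixSwap (i j : ℕ) (h1 : 1 ≤ i) (h2 : i ≤ n) (h3 : 1 ≤ j) (h4 : j ≤ n) (h5 : i ≠ j) :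
      CRel n (gn n (-(i : ℤ)) * gn n (j : ℤ)) ((-qA) • (gn n (j : ℤ) * gn n (-(i : ℤ))))
  | main (i : ℕ) (h1 : 1 ≤ i) (h2 : i ≤ n) :
      CRel n (gn n (-(i : ℤ)) * gn n (i : ℤ))
        ((-(qA ^ 2)) • (gn n (i : ℤ) * gn n (-(i : ℤ))) +
          (qA - qAinv) •
            ∑ k ∈ Finset.Icc 1 (n - i),
              ((-qA) ^ (k + 1)) • (gn n ((i + k : ℕ) : ℤ) * gn n (-((i + k : ℕ) : ℤ))))

/-- The quantum exterior algebra of type C, `Λ_A`. -/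
abbrev LamAlg (n : ℕ) : Type := RingQuot (CRel n)

/-- The generator `v_x ∈ Λ_A`. -/
def va (n : ℕ) (x : ℤ) : LamAlg n := RingQuot.mkAlgHom AL (CRel n) (gn n x)

/-- The minimum of a nonempty finset of integers with respect to the order of `I`
(positives first, then negatives). -/
def iMin (S : Finset ℤ) (h : S.Nonempty) : ℤ :=
  if hp : (S.filter (fun x => 0 < x)).Nonempty then (S.filter (fun x => 0 < x)).min' hp
  else S.min' h

theorem iMin_mem (S : Finset ℤ) (h : S.Nonempty) : iMin S h ∈ S := by
  unfold iMin
  split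
  · exact Finset.mem_of_mem_filter _ (Finset.min'_mem _ _)
  · exact Finset.min'_mem _ _

/-- The maximum of a nonempty finset of integers with respect to the order of `I`. -/
def iMax (S : Finset ℤ) (h : S.Nonempty) : ℤ :=
  if hp : (S.filter (fun x => x < 0)).Nonempty then (S.filter (fun x => x < 0)).max' hp
  else S.max' h

theorem iMax_mem (S : Finset ℤ) (h : S.Nonempty) : iMax S h ∈ S := by
  unfold iMax
  split
  · exact Finset.mem_of_mem_filter _ (Finset.max'_mem _ _)
  · exact Finset.max'_mem _ _

/-- The standard monomial `v_S = v_{x_1} v_{x_2} ⋯ v_{x_m}` for `S = {x_1 < ⋯ < x_m}`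
(in the order of `I`). -/
def vset (n : ℕ) (S : Finset ℤ) : LamAlg n :=
  if h : S.Nonempty then va n (iMin S h) * vset n (S.erase (iMin S h)) else 1
termination_by S.card
decreasing_by exact Finset.card_erase_lt_of_mem (iMin_mem S h)

/-- The reversed standard monomial `v_S^{rev} = v_{x_m} ⋯ v_{x_2} v_{x_1}`. -/
def vsetRev (n : ℕ) (S : Finset ℤ) : LamAlg n :=
  if h : S.Nonempty then va n (iMax S h) * vsetRev n (S.erase (iMax S h)) else 1
termination_by S.card
decreasing_by exact Finset.card_erase_lt_of_mem (iMax_mem S h)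

/-- `−S`. -/
def negSet (S : Finset ℤ) : Finset ℤ := S.image (fun x => -x)

/-- The scalar appearing in the definition of the bar map. -/
def barScalar (S : Finset ℤ) : AL :=
  (-qAinv) ^ (S.card * (S.card - 1) / 2) *
    LaurentPolynomial.T (-(((S ∩ negSet S).card / 2 : ℕ) : ℤ))

/-- One step of the matching algorithm at column `x`, acting on the pair
(partial assignment, set `U` of unmatched undotted columns). -/
def stepCol (S : Finset ℤ) (x : ℤ) (p : (ℤ → ℤ) × Finset ℤ) : (ℤ → ℤ) × Finset ℤ :=
  if x ∈ S ∧ -x ∈ S then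
    (if hU : p.2.Nonempty then
      (Function.update p.1 x (p.2.min' hU), p.2.erase (p.2.min' hU))
     else (Function.update p.1 x x, p.2))
  else if x ∉ S ∧ -x ∉ S then (p.1, insert x p.2)
  else p

/-- Running the matching algorithm over the columns `n, n−1, …, 1`. -/
def matchData (n : ℕ) (S : Finset ℤ) : (ℤ → ℤ) × Finset ℤ :=
  ((List.range n).map (fun t => (n : ℤ) - t)).foldl (fun p x => stepCol S x p) (id, ∅)

/-- The matching `x ↦ x^S`. -/
def matchCol (n : ℕ) (S : Finset ℤ) (x : ℤ) : ℤ := (matchData n S).1 x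

/-- L(S): fully dotted columns matched to an undotted column. -/
def LSet (n : ℕ) (S : Finset ℤ) : Finset ℤ :=
  (Finset.Icc (1 : ℤ) (n : ℤ)).filter (fun x => x ∈ S ∧ -x ∈ S ∧ matchCol n S x ≠ x)

/-- ±X. -/
def pmSet (X : Finset ℤ) : Finset ℤ := X ∪ negSet X

/-- The canonical basis vector b_S in Λ_A. -/
def bSvec (n : ℕ) (S : Finset ℤ) : LamAlg n :=
  ∑ X ∈ (LSet n S).powerset,
    (LaurentPolynomial.T (-(X.card : ℤ)) : AL) •
      vset n ((S \ pmSet X) ∪ pmSet (X.image (matchCol n S)))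

/-- The (weak) order of `I` on nonzero integers: positives first, then negatives. -/
def ILe (a x : ℤ) : Prop := (0 < a ∧ (x < 0 ∨ a ≤ x)) ∨ (a < 0 ∧ x < 0 ∧ a ≤ x)

theorem ILe.antisymm {a b : ℤ} (h1 : ILe a b) (h2 : ILe b a) : a = b := by
  unfold ILe at *
  omega

theorem iMin_le {S : Finset ℤ} (h : S.Nonempty) (h0 : (0 : ℤ) ∉ S) {x : ℤ} (hx : x ∈ S) :
    ILe (iMin S h) x := by
  have hx0 : x ≠ 0 := fun h => h0 (h ▸ hx)
  unfold iMin ILe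
  split_ifs with hp
  · have h1 := Finset.min'_mem _ hp
    rw [Finset.mem_filter] at h1
    refine Or.inl ⟨h1.2, ?_⟩
    rcases lt_or_gt_of_ne hx0 with h2 | h2
    · exact Or.inl h2
    · exact Or.inr (Finset.min'_le _ _ (by simp [hx, h2]))
  · have hneg : ∀ y ∈ S, y < 0 := fun y hy => by
      by_contra hc
      have hy0 : y ≠ 0 := fun h => h0 (h ▸ hy)
      exact hp ⟨y, by rw [Finset.mem_filter]; exact ⟨hy, by omega⟩⟩
    exact Or.inr ⟨hneg _ (Finset.min'_mem _ _), hneg _ hx, Finset.min'_le _ _ hx⟩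

theorem le_iMax {S : Finset ℤ} (h : S.Nonempty) (h0 : (0 : ℤ) ∉ S) {x : ℤ} (hx : x ∈ S) :
    ILe x (iMax S h) := by
  have hx0 : x ≠ 0 := fun h => h0 (h ▸ hx)
  unfold iMax ILe
  split_ifs with hp
  · have h1 := Finset.max'_mem _ hp
    rw [Finset.mem_filter] at h1
    rcases lt_or_gt_of_ne hx0 with h2 | h2
    · exact Or.inr ⟨h2, h1.2, Finset.le_max' _ _ (by simp [hx, h2])⟩
    · exact Or.inl ⟨h2, Or.inl h1.2⟩
  · have hpos : ∀ y ∈ S, 0 < y := fun y hy => by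
      by_contra hc
      have hy0 : y ≠ 0 := fun h => h0 (h ▸ hy)
      exact hp ⟨y, by rw [Finset.mem_filter]; exact ⟨hy, by omega⟩⟩
    exact Or.inl ⟨hpos _ hx, Or.inr (Finset.le_max' _ _ hx)⟩

theorem vset_empty (n : ℕ) : vset n ∅ = 1 := by
  rw [vset]; simp

theorem vsetRev_empty (n : ℕ) : vsetRev n ∅ = 1 := by
  rw [vsetRev]; simp

theorem vset_eq_of_isMin (n : ℕ) {S : Finset ℤ} (h0 : (0 : ℤ) ∉ S) {a : ℤ} (ha : a ∈ S)
    (hmin : ∀ x ∈ S, ILe a x) : vset n S = va n a * vset n (S.erase a) := by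
  have h : S.Nonempty := ⟨a, ha⟩
  have : iMin S h = a := (iMin_le h h0 ha).antisymm (hmin _ (iMin_mem S h))
  rw [vset, dif_pos h, this]

theorem vsetRev_eq_of_isMax (n : ℕ) {S : Finset ℤ} (h0 : (0 : ℤ) ∉ S) {a : ℤ} (ha : a ∈ S)
    (hmax : ∀ x ∈ S, ILe x a) : vsetRev n S = va n a * vsetRev n (S.erase a) := by
  have h : S.Nonempty := ⟨a, ha⟩
  have : iMax S h = a := (hmax _ (iMax_mem S h)).antisymm (le_iMax h h0 ha)
  rw [vsetRev, dif_pos h, this]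

theorem vset_insert_min (n : ℕ) {S : Finset ℤ} (h0 : (0 : ℤ) ∉ S) {c : ℤ} (hc : c ≠ 0)
    (hcS : c ∉ S) (h : ∀ x ∈ S, ILe c x) : vset n (insert c S) = va n c * vset n S := by
  have hcc : ILe c c := by unfold ILe; omega
  rw [vset_eq_of_isMin n (a := c) (by simp [h0, hc.symm]) (by simp) (by simpa [hcc] using h),
    Finset.erase_insert hcS]

theorem vsetRev_insert_max (n : ℕ) {S : Finset ℤ} (h0 : (0 : ℤ) ∉ S) {c : ℤ} (hc : c ≠ 0)
    (hcS : c ∉ S) (h : ∀ x ∈ S, ILe x c) : vsetRev n (insert c S) = va n c * vsetRev n S := by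
  have hcc : ILe c c := by unfold ILe; omega
  rw [vsetRev_eq_of_isMax n (a := c) (by simp [h0, hc.symm]) (by simp) (by simpa [hcc] using h),
    Finset.erase_insert hcS]

theorem vset_insert_max (n : ℕ) {c : ℤ} (hc : c ≠ 0) (S : Finset ℤ) (h0 : (0 : ℤ) ∉ S)
    (hcS : c ∉ S) (h : ∀ x ∈ S, ILe x c) : vset n (insert c S) = vset n S * va n c := by
  induction hm : S.card generalizing S with
  | zero =>
    obtain rfl := Finset.card_eq_zero.1 hm
    rw [vset_insert_min n h0 hc hcS (by simp), vset_empty, one_mul, mul_one]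
  | succ m ih =>
    have hne : S.Nonempty := Finset.card_pos.1 (by omega)
    have ha := iMin_mem S hne
    have hmin : ∀ x ∈ S, ILe (iMin S hne) x := fun x hx => iMin_le hne h0 hx
    rw [vset_eq_of_isMin n (a := iMin S hne) (S := insert c S) (by simp [h0, hc.symm])
      (by simp [ha]) (by simpa [h _ ha] using hmin), vset_eq_of_isMin n h0 ha hmin,
      Finset.erase_insert_of_ne (ne_of_mem_of_not_mem ha hcS).symm, mul_assoc]
    congr 1
    exact ih _ (by simp [h0]) (by simp [hcS]) (fun x hx => h x (Finset.mem_of_mem_erase hx))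
      (by rw [Finset.card_erase_of_mem ha]; omega)

theorem vsetRev_insert_min (n : ℕ) {c : ℤ} (hc : c ≠ 0) (S : Finset ℤ) (h0 : (0 : ℤ) ∉ S)
    (hcS : c ∉ S) (h : ∀ x ∈ S, ILe c x) : vsetRev n (insert c S) = vsetRev n S * va n c := by
  induction hm : S.card generalizing S with
  | zero =>
    obtain rfl := Finset.card_eq_zero.1 hm
    rw [vsetRev_insert_max n h0 hc hcS (by simp), vsetRev_empty, one_mul, mul_one]
  | succ m ih =>
    have hne : S.Nonempty := Finset.card_pos.1 (by omega)
    have ha := iMax_mem S hne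
    have hmax : ∀ x ∈ S, ILe x (iMax S hne) := fun x hx => le_iMax hne h0 hx
    rw [vsetRev_eq_of_isMax n (a := iMax S hne) (S := insert c S) (by simp [h0, hc.symm])
      (by simp [ha]) (by simpa [h _ ha] using hmax), vsetRev_eq_of_isMax n h0 ha hmax,
      Finset.erase_insert_of_ne (ne_of_mem_of_not_mem ha hcS).symm, mul_assoc]
    congr 1
    exact ih _ (by simp [h0]) (by simp [hcS]) (fun x hx => h x (Finset.mem_of_mem_erase hx))
      (by rw [Finset.card_erase_of_mem ha]; omega)

theorem qA_mul_qAinv : qA * qAinv = 1 := by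
  rw [qA, qAinv, ← LaurentPolynomial.T_add]; simp

theorem va_eq_zero {n : ℕ} {x : ℤ} (hx : x ∉ Iset n) : va n x = 0 := by
  rw [va, gn, dif_neg hx, map_zero]

theorem mem_Iset {n : ℕ} {x : ℤ} : x ∈ Iset n ↔ x ≠ 0 ∧ -(n : ℤ) ≤ x ∧ x ≤ n := by
  simp [Iset]

theorem va_mul_self (n : ℕ) (x : ℤ) : va n x * va n x = 0 := by
  by_cases hx : x ∈ Iset n
  · rw [va, ← map_mul, RingQuot.mkAlgHom_rel AL (CRel.sq x hx), map_zero]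
  · rw [va_eq_zero hx, mul_zero]

theorem va_swap_pos {n : ℕ} {i j : ℤ} (hi : 0 < i) (hij : i < j) :
    va n j * va n i = (-qA) • (va n i * va n j) := by
  by_cases hj : j ≤ n
  · lift i to ℕ using hi.le
    lift j to ℕ using by omega
    simp only [va, ← map_mul, ← map_smul]
    exact RingQuot.mkAlgHom_rel AL (CRel.posSwap i j (by omega) (by omega) (by omega))
  · rw [va_eq_zero (x := j) (by rw [mem_Iset]; omega)]; simp

theorem va_swap_neg {n : ℕ} {i j : ℤ} (hi : 0 < i) (hij : i < j) :
    va n (-i) * va n (-j) = (-qA) • (va n (-j) * va n (-i)) := by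
  by_cases hj : j ≤ n
  · lift i to ℕ using hi.le
    lift j to ℕ using by omega
    simp only [va, ← map_mul, ← map_smul]
    exact RingQuot.mkAlgHom_rel AL (CRel.negSwap i j (by omega) (by omega) (by omega))
  · rw [va_eq_zero (x := -j) (by rw [mem_Iset]; omega)]; simp

theorem va_swap_mix {n : ℕ} {i j : ℤ} (hi : 0 < i) (hj : 0 < j) (hij : i ≠ j) :
    va n (-i) * va n j = (-qA) • (va n j * va n (-i)) := by
  by_cases hjn : j ≤ n
  · by_cases hin : i ≤ n
    · lift i to ℕ using hi.le
      lift j to ℕ using hj.le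
      simp only [va, ← map_mul, ← map_smul]
      exact RingQuot.mkAlgHom_rel AL
        (CRel.mixSwap i j (by omega) (by omega) (by omega) (by omega) (by omega))
    · rw [va_eq_zero (x := -i) (by rw [mem_Iset]; omega)]; simp
  · rw [va_eq_zero (x := j) (by rw [mem_Iset]; omega)]; simp

theorem va_main {n : ℕ} (i : ℕ) (h1 : 1 ≤ i) (h2 : i ≤ n) :
    va n (-(i : ℤ)) * va n i = (-(qA ^ 2)) • (va n (i : ℤ) * va n (-(i : ℤ))) +
      (qA - qAinv) • ∑ k ∈ Finset.Icc 1 (n - i),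
        ((-qA) ^ (k + 1)) • (va n ((i + k : ℕ) : ℤ) * va n (-((i + k : ℕ) : ℤ))) := by
  have := RingQuot.mkAlgHom_rel AL (CRel.main (n := n) i h1 h2)
  simpa only [va, ← map_mul, ← map_smul, ← map_add, ← map_sum] using this

/-- `a` and `b` commute up to the scalar `s`. -/
def SCommute {R B : Type} [CommSemiring R] [Semiring B] [Algebra R B] (s : R) (a b : B) : Prop :=
  a * b = s • (b * a)

namespace SCommute

variable {R B : Type} [CommSemiring R] [Semiring B] [Algebra R B] {s t : R} {a b c : B}

theorem one_right : SCommute (1 : R) a 1 := by simp [SCommute]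

theorem mul_right (h1 : SCommute s a b) (h2 : SCommute t a c) :
    SCommute (s * t) a (b * c) := by
  unfold SCommute at *
  rw [← mul_assoc, h1, smul_mul_assoc, mul_assoc, h2, mul_smul_comm, smul_smul, mul_assoc]

theorem mul_left (h1 : SCommute s a c) (h2 : SCommute t b c) :
    SCommute (s * t) (a * b) c := by
  unfold SCommute at *
  rw [mul_assoc, h2, mul_smul_comm, ← mul_assoc, h1, smul_mul_assoc, smul_smul, mul_assoc,
    mul_comm t]

theorem symm (h : SCommute s a b) (hst : t * s = 1) : SCommute t b a := by
  unfold SCommute at *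
  rw [h, smul_smul, hst, one_smul]

theorem congr (h : SCommute s a b) (hst : s = t) : SCommute t a b := hst ▸ h

theorem smul_right (h : SCommute s a b) : SCommute s a (t • b) := by
  unfold SCommute at *
  rw [mul_smul_comm, h, smul_mul_assoc, smul_smul, smul_smul, mul_comm]

theorem map_prod {ι W : Type} [DecidableEq ι] [CommSemiring W] [Algebra R W] (φ : W →ₐ[R] B)
    {D : Finset ι} {f : ι → W} (h : ∀ j ∈ D, SCommute s a (φ (f j))) :
    SCommute (s ^ D.card) a (φ (∏ j ∈ D, f j)) := by
  induction D using Finset.induction_on with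
  | empty => simpa using one_right
  | insert j D hj ih =>
    rw [Finset.prod_insert hj, map_mul, Finset.card_insert_of_notMem hj]
    exact ((h j (by simp)).mul_right (ih fun i hi => h i (by simp [hi]))).congr (by ring)

theorem sandwich {s₁ s₂ s₃ : R} {x y P F N : B} (h1 : SCommute s₁ x P) (h2 : SCommute s₂ x F)
    (h3 : SCommute s₃ N y) :
    x * (P * F * N) * y = (s₁ * s₂ * s₃) • (P * (F * (x * y)) * N) := by
  have h12 := h1.mul_right h2
  unfold SCommute at h12 h3
  rw [← mul_assoc, h12, smul_mul_assoc, smul_mul_assoc, mul_assoc _ N, h3, mul_smul_comm,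
    smul_smul]
  simp only [mul_assoc]

end SCommute

theorem neg_qAinv_mul : -qAinv * -qA = 1 := by
  linear_combination qA_mul_qAinv

theorem scommute_pos {n : ℕ} {c j : ℤ} (hc : 0 < c) (hj : c < |j|) :
    SCommute (-qAinv) (va n c) (va n j) := by
  rcases le_or_gt 0 j with h | h
  · rw [abs_of_nonneg h] at hj
    exact SCommute.symm (va_swap_pos hc hj) neg_qAinv_mul
  · rw [abs_of_neg h] at hj
    have := va_swap_mix (n := n) (i := -j) (j := c) (by omega) hc (by omega)
    rw [neg_neg] at this
    exact SCommute.symm this neg_qAinv_mul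

theorem scommute_neg {n : ℕ} {c j : ℤ} (hc : 0 < c) (hj : c < |j|) :
    SCommute (-qA) (va n (-c)) (va n j) := by
  rcases le_or_gt 0 j with h | h
  · rw [abs_of_nonneg h] at hj
    exact va_swap_mix hc (by omega) (by omega)
  · rw [abs_of_neg h] at hj
    have := va_swap_neg (n := n) (i := c) (j := -j) hc (by omega)
    rwa [neg_neg] at this

/-- The product `v_c v_{-c}`. -/
def wa (n : ℕ) (c : ℤ) : LamAlg n := va n c * va n (-c)

theorem scommute_pos_wa {n : ℕ} {c j : ℤ} (hc : 0 < c) (hj : c < |j|) :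
    SCommute (qAinv ^ 2) (va n c) (wa n j) :=
  ((scommute_pos hc hj).mul_right (scommute_pos hc (by rwa [abs_neg]))).congr (by ring)

theorem scommute_neg_wa {n : ℕ} {c j : ℤ} (hc : 0 < c) (hj : c < |j|) :
    SCommute (qA ^ 2) (va n (-c)) (wa n j) :=
  ((scommute_neg hc hj).mul_right (scommute_neg hc (by rwa [abs_neg]))).congr (by ring)

theorem wa_mul_wa_neg (n : ℕ) (c : ℤ) : wa n c * wa n (-c) = 0 := by
  rw [wa, wa, neg_neg, mul_assoc, ← mul_assoc (va n (-c)), va_mul_self, zero_mul, mul_zero]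

theorem wa_comm_of_lt {n : ℕ} {i j : ℤ} (hi : i ≠ 0) (hij : |i| < |j|) :
    wa n i * wa n j = wa n j * wa n i := by
  have hqq : qAinv ^ 2 * qA ^ 2 = 1 := by
    rw [← mul_pow, mul_comm, qA_mul_qAinv, one_pow]
  have key : SCommute (1 : AL) (wa n i) (wa n j) := by
    rcases lt_or_gt_of_ne hi with h | h
    · rw [abs_of_neg h] at hij
      have h1 := scommute_neg_wa (n := n) (c := -i) (by omega) hij
      rw [neg_neg] at h1
      have h2 := scommute_pos_wa (n := n) (c := -i) (by omega) hij
      exact (h1.mul_left h2).congr (by rw [mul_comm, hqq])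
    · rw [abs_of_pos h] at hij
      exact ((scommute_pos_wa h hij).mul_left (scommute_neg_wa h hij)).congr hqq
  rw [key, one_smul]

theorem wa_comm (n : ℕ) (i j : ℤ) : wa n i * wa n j = wa n j * wa n i := by
  have hz : ∀ k : ℤ, k = 0 → wa n k = 0 := fun k hk => by
    rw [wa, va_eq_zero (by rw [mem_Iset]; omega), zero_mul]
  by_cases hi : i = 0
  · rw [hz i hi]; simp
  by_cases hj : j = 0
  · rw [hz j hj]; simp
  rcases lt_trichotomy |i| |j| with h | h | h
  · exact wa_comm_of_lt hi h
  · rcases abs_eq_abs.1 h with rfl | rfl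
    · rfl
    · have := wa_mul_wa_neg n (-j)
      rw [neg_neg] at this
      rw [this, wa_mul_wa_neg]
  · exact (wa_comm_of_lt hj h).symm

open scoped IsMulCommutative in
/-- A commuting family in an algebra comes from a commutative algebra. -/
theorem exists_commRing_of_commute {ι R B : Type} [CommRing R] [Ring B] [Algebra R B] (f : ι → B)
    (hf : ∀ i j, f i * f j = f j * f i) : ∃ (W : Type) (_ : CommRing W) (_ : Algebra R W)
    (φ : W →ₐ[R] B) (w : ι → W), Function.Injective φ ∧ ∀ c, φ (w c) = f c := by
  have hs : ∀ a ∈ Set.range f, ∀ b ∈ Set.range f, a * b = b * a := by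
    rintro _ ⟨i, rfl⟩ _ ⟨j, rfl⟩
    exact hf i j
  have := Algebra.isMulCommutative_adjoin R hs
  exact ⟨Algebra.adjoin R (Set.range f), inferInstance, inferInstance,
    (Algebra.adjoin R (Set.range f)).val,
    fun c => ⟨f c, Algebra.subset_adjoin ⟨c, rfl⟩⟩, Subtype.val_injective, fun c => rfl⟩

/-- The part of `S` supported on the columns `n, n-1, …, n-k+1`. -/
def upper (n : ℕ) (S : Finset ℤ) (k : ℕ) : Finset ℤ := S.filter (fun x => (n : ℤ) - k < |x|)

/-- The fully dotted columns among `n, n-1, …, n-k+1`. -/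
def dots (n : ℕ) (S : Finset ℤ) (k : ℕ) : Finset ℤ :=
  (Finset.Ioc ((n : ℤ) - k) n).filter (fun x => x ∈ S ∧ -x ∈ S)

/-- The ordered product of the `v_c` over the columns `c` among `n, …, n-k+1` with
`c ∈ S` and `-c ∉ S`. -/
def posFactor (n : ℕ) (S : Finset ℤ) : ℕ → LamAlg n
  | 0 => 1
  | k + 1 => (if ((n : ℤ) - k) ∈ S ∧ -((n : ℤ) - k) ∉ S then va n ((n : ℤ) - k) else 1) *
      posFactor n S k

/-- The ordered product of the `v_{-c}` over the columns `c` among `n, …, n-k+1` with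
`c ∉ S` and `-c ∈ S`. -/
def negFactor (n : ℕ) (S : Finset ℤ) : ℕ → LamAlg n
  | 0 => 1
  | k + 1 => negFactor n S k *
      (if ((n : ℤ) - k) ∉ S ∧ -((n : ℤ) - k) ∈ S then va n (-((n : ℤ) - k)) else 1)

/-- The number of factors of `posFactor`. -/
def posCount (n : ℕ) (S : Finset ℤ) : ℕ → ℕ
  | 0 => 0
  | k + 1 => (if ((n : ℤ) - k) ∈ S ∧ -((n : ℤ) - k) ∉ S then 1 else 0) + posCount n S k

/-- The number of factors of `negFactor`. -/
def negCount (n : ℕ) (S : Finset ℤ) : ℕ → ℕ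
  | 0 => 0
  | k + 1 => (if ((n : ℤ) - k) ∉ S ∧ -((n : ℤ) - k) ∈ S then 1 else 0) + negCount n S k

/-- The number of columns among `n, …, n-k+1` with exactly one dot. -/
def singleCount (n : ℕ) (S : Finset ℤ) (k : ℕ) : ℕ := posCount n S k + negCount n S k

theorem SCommute.posFactor_right {n : ℕ} (S : Finset ℤ) {s : AL} {a : LamAlg n} {k : ℕ} (hk : k ≤ n)
    (h : ∀ j, (n : ℤ) - k < |j| → SCommute s a (va n j)) :
    SCommute (s ^ posCount n S k) a (posFactor n S k) := by
  induction k with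
  | zero => exact one_right.congr (by simp [posCount])
  | succ k ih =>
    have ih' := ih (by omega) (fun j hj => h j (by push_cast; omega))
    rw [posFactor, posCount]
    split_ifs
    · refine ((h _ ?_).mul_right ih').congr (by ring)
      rw [abs_of_nonneg (by omega)]; push_cast; omega
    · exact (one_right.mul_right ih').congr (by ring)

theorem SCommute.negFactor_right {n : ℕ} (S : Finset ℤ) {s : AL} {a : LamAlg n} {k : ℕ} (hk : k ≤ n)
    (h : ∀ j, (n : ℤ) - k < |j| → SCommute s a (va n j)) :
    SCommute (s ^ negCount n S k) a (negFactor n S k) := by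
  induction k with
  | zero => exact one_right.congr (by simp [negCount])
  | succ k ih =>
    have ih' := ih (by omega) (fun j hj => h j (by push_cast; omega))
    rw [negFactor, negCount]
    split_ifs
    · refine (ih'.mul_right (h _ ?_)).congr (by ring)
      rw [abs_neg, abs_of_nonneg (by omega)]; push_cast; omega
    · exact (ih'.mul_right one_right).congr (by ring)

section Upper

variable {n k : ℕ} {S : Finset ℤ}

theorem lt_abs_step {m x : ℤ} (hm : 0 < m) : m - 1 < |x| ↔ m < |x| ∨ x = m ∨ x = -m := by
  rcases abs_cases x with h | h <;> omega

theorem mem_upper_succ (hk : k < n) {x : ℤ} : x ∈ upper n S (k + 1) ↔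
    x ∈ upper n S k ∨ (x ∈ S ∧ (x = (n : ℤ) - k ∨ x = -((n : ℤ) - k))) := by
  have := lt_abs_step (m := (n : ℤ) - k) (x := x) (by omega)
  simp only [upper, Finset.mem_filter]
  rw [← and_or_left, ← this]
  push_cast
  rw [sub_sub]

theorem upper_succ_pos (hk : k < n) (h1 : (n : ℤ) - k ∈ S) (h2 : -((n : ℤ) - k) ∉ S) :
    upper n S (k + 1) = insert ((n : ℤ) - k) (upper n S k) := by
  ext x
  rw [mem_upper_succ hk, Finset.mem_insert]
  by_cases hx : x = (n : ℤ) - k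
  · subst hx; simp [-neg_sub, h1]
  · by_cases hx' : x = -((n : ℤ) - k)
    · subst hx'; simp [-neg_sub, h2, hx]
    · simp [-neg_sub, hx, hx']

theorem upper_succ_neg (hk : k < n) (h1 : (n : ℤ) - k ∉ S) (h2 : -((n : ℤ) - k) ∈ S) :
    upper n S (k + 1) = insert (-((n : ℤ) - k)) (upper n S k) := by
  ext x
  rw [mem_upper_succ hk, Finset.mem_insert]
  by_cases hx : x = (n : ℤ) - k
  · subst hx; simp [-neg_sub, h1]; omega
  · by_cases hx' : x = -((n : ℤ) - k)
    · subst hx'; simp [-neg_sub, h2]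
    · simp [-neg_sub, hx, hx']

theorem upper_succ_both (hk : k < n) (h1 : (n : ℤ) - k ∈ S) (h2 : -((n : ℤ) - k) ∈ S) :
    upper n S (k + 1) = insert ((n : ℤ) - k) (insert (-((n : ℤ) - k)) (upper n S k)) := by
  ext x
  rw [mem_upper_succ hk, Finset.mem_insert, Finset.mem_insert]
  by_cases hx : x = (n : ℤ) - k
  · subst hx; simp [-neg_sub, h1]
  · by_cases hx' : x = -((n : ℤ) - k)
    · subst hx'; simp [-neg_sub, h2]
    · simp [-neg_sub, hx, hx']

theorem upper_succ_none (hk : k < n) (h1 : (n : ℤ) - k ∉ S) (h2 : -((n : ℤ) - k) ∉ S) :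
    upper n S (k + 1) = upper n S k := by
  ext x
  rw [mem_upper_succ hk]
  by_cases hx : x = (n : ℤ) - k
  · subst hx; simp [-neg_sub, h1]
  · by_cases hx' : x = -((n : ℤ) - k)
    · subst hx'; simp [-neg_sub, h2]
    · simp [-neg_sub, hx, hx']

theorem dots_succ : dots n S (k + 1) =
    if (n : ℤ) - k ∈ S ∧ -((n : ℤ) - k) ∈ S then insert ((n : ℤ) - k) (dots n S k)
    else dots n S k := by
  have : Finset.Ioc ((n : ℤ) - (k + 1 : ℕ)) n =
      insert ((n : ℤ) - k) (Finset.Ioc ((n : ℤ) - k) n) := by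
    ext x; simp; omega
  rw [dots, this, Finset.filter_insert, dots]

theorem notMem_dots : (n : ℤ) - k ∉ dots n S k := by simp [dots]

theorem zero_notMem_upper (hk : k ≤ n) : (0 : ℤ) ∉ upper n S k := by
  simp [upper, hk]

theorem lt_of_mem_upper {x : ℤ} (hx : x ∈ upper n S k) : (n : ℤ) - k < |x| := by
  simpa [upper] using (Finset.mem_filter.1 hx).2

theorem ile_of_mem_upper (hk : k < n) {x : ℤ} (hx : x ∈ upper n S k) :
    ILe ((n : ℤ) - k) x ∧ ILe x (-((n : ℤ) - k)) := by
  have := lt_of_mem_upper hx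
  unfold ILe
  rcases abs_cases x with h | h <;> omega

theorem col_notMem_upper (hk : k < n) :
    (n : ℤ) - k ∉ upper n S k ∧ -((n : ℤ) - k) ∉ upper n S k := by
  constructor <;> intro h <;> have := lt_of_mem_upper h
  · rw [abs_of_nonneg (by omega)] at this; omega
  · rw [abs_neg, abs_of_nonneg (by omega)] at this; omega

theorem vset_insert_col (hk : k < n) :
    vset n (insert ((n : ℤ) - k) (upper n S k)) = va n ((n : ℤ) - k) * vset n (upper n S k) :=
  vset_insert_min n (zero_notMem_upper hk.le) (by omega) (col_notMem_upper hk).1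
    fun _ hx => (ile_of_mem_upper hk hx).1

theorem vset_insert_neg_col (hk : k < n) :
    vset n (insert (-((n : ℤ) - k)) (upper n S k)) =
      vset n (upper n S k) * va n (-((n : ℤ) - k)) :=
  vset_insert_max n (by omega) _ (zero_notMem_upper hk.le) (col_notMem_upper hk).2
    fun _ hx => (ile_of_mem_upper hk hx).2

theorem col_notMem_insert (hk : k < n) :
    (n : ℤ) - k ∉ insert (-((n : ℤ) - k)) (upper n S k) := by
  rw [Finset.mem_insert]
  rintro (h | h)
  · omega
  · exact (col_notMem_upper hk).1 h

theorem zero_notMem_insert (hk : k < n) :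
    (0 : ℤ) ∉ insert (-((n : ℤ) - k)) (upper n S k) := by
  rw [Finset.mem_insert]
  rintro (h | h)
  · omega
  · exact zero_notMem_upper hk.le h

theorem ile_insert (hk : k < n) : ∀ x ∈ insert (-((n : ℤ) - k)) (upper n S k),
    ILe ((n : ℤ) - k) x := by
  simp only [Finset.mem_insert, forall_eq_or_imp]
  exact ⟨by unfold ILe; omega, fun x hx => (ile_of_mem_upper hk hx).1⟩

theorem vset_insert_both (hk : k < n) :
    vset n (insert ((n : ℤ) - k) (insert (-((n : ℤ) - k)) (upper n S k))) =
      va n ((n : ℤ) - k) * vset n (upper n S k) * va n (-((n : ℤ) - k)) := by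
  rw [vset_insert_min n (zero_notMem_insert hk) (by omega) (col_notMem_insert hk) (ile_insert hk),
    vset_insert_neg_col hk, mul_assoc]

theorem vsetRev_insert_col (hk : k < n) :
    vsetRev n (insert ((n : ℤ) - k) (upper n S k)) =
      vsetRev n (upper n S k) * va n ((n : ℤ) - k) :=
  vsetRev_insert_min n (by omega) _ (zero_notMem_upper hk.le) (col_notMem_upper hk).1
    fun _ hx => (ile_of_mem_upper hk hx).1

theorem vsetRev_insert_neg_col (hk : k < n) :
    vsetRev n (insert (-((n : ℤ) - k)) (upper n S k)) =
      va n (-((n : ℤ) - k)) * vsetRev n (upper n S k) :=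
  vsetRev_insert_max n (zero_notMem_upper hk.le) (by omega) (col_notMem_upper hk).2
    fun _ hx => (ile_of_mem_upper hk hx).2

theorem vsetRev_insert_both (hk : k < n) :
    vsetRev n (insert ((n : ℤ) - k) (insert (-((n : ℤ) - k)) (upper n S k))) =
      va n (-((n : ℤ) - k)) * vsetRev n (upper n S k) * va n ((n : ℤ) - k) := by
  rw [vsetRev_insert_min n (by omega) _ (zero_notMem_insert hk) (col_notMem_insert hk)
    (ile_insert hk), vsetRev_insert_neg_col hk]

theorem upper_zero (hS : S ⊆ Iset n) : upper n S 0 = ∅ := by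
  rw [Finset.eq_empty_iff_forall_notMem]
  intro x hx
  have h1 := lt_of_mem_upper hx
  have h2 := mem_Iset.1 (hS (Finset.mem_filter.1 hx).1)
  rcases abs_cases x with h | h <;> push_cast at h1 <;> omega

theorem upper_self (hS : S ⊆ Iset n) : upper n S n = S := by
  refine Finset.filter_true_of_mem fun x hx => ?_
  have h2 := mem_Iset.1 (hS hx)
  simpa using h2.1

theorem dots_zero : dots n S 0 = ∅ := by simp [dots]

end Upper

/-- The scalar attached to a fully dotted column `c`: one factor `-q⁻¹` for each column
beyond `c` carrying exactly one dot. -/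
def twist (n : ℕ) (S : Finset ℤ) (c : ℤ) : AL :=
  (-qAinv) ^ singleCount n S ((n : ℤ) - c).toNat

theorem twist_col {n k : ℕ} {S : Finset ℤ} :
    twist n S ((n : ℤ) - k) = (-qAinv) ^ singleCount n S k := by
  simp [twist]

section Factor

variable {n : ℕ} {S : Finset ℤ} {W : Type} [CommRing W] [Algebra AL W] (φ : W →ₐ[AL] LamAlg n)
  {w : ℤ → W}

theorem lt_abs_of_mem_dots {k : ℕ} {j : ℤ} (hj : j ∈ dots n S k) : (n : ℤ) - k < |j| := by
  simp only [dots, Finset.mem_filter, Finset.mem_Ioc] at hj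
  exact lt_of_lt_of_le hj.1.1 (le_abs_self j)

theorem succ_mul_self (d : ℕ) : (d + 1) * (d + 1 - 1) = d * (d - 1) + 2 * d := by
  rcases d with _ | d
  · rfl
  · simp only [Nat.add_sub_cancel]; ring

theorem neg_qA_pow_mul (r : ℕ) : (-qA) ^ r * (-qAinv) ^ r = 1 := by
  rw [← mul_pow, mul_comm, neg_qAinv_mul, one_pow]

theorem neg_qAinv_pow_mul (r : ℕ) : (-qAinv) ^ r * (-qA) ^ r = 1 := by
  rw [mul_comm, neg_qA_pow_mul]

theorem vset_upper_both_step (hw : ∀ c, φ (w c) = wa n c) {k : ℕ} (hk : k < n) {g : ℤ → AL} :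
    va n ((n : ℤ) - k) * (posFactor n S k * φ (∏ c ∈ dots n S k, g c • w c) * negFactor n S k) *
      va n (-((n : ℤ) - k)) = ((-qAinv) ^ singleCount n S k * qAinv ^ (2 * (dots n S k).card)) •
      (posFactor n S k * φ (w ((n : ℤ) - k) * ∏ c ∈ dots n S k, g c • w c) * negFactor n S k) := by
  have hc : (0 : ℤ) < (n : ℤ) - k := by omega
  have e1 := SCommute.posFactor_right S hk.le (fun j hj => scommute_pos (n := n) hc hj)
  have e2 : SCommute ((qAinv ^ 2) ^ (dots n S k).card) (va n ((n : ℤ) - k))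
      (φ (∏ c ∈ dots n S k, g c • w c)) := by
    refine SCommute.map_prod φ fun j hj => ?_
    rw [map_smul, hw]
    exact (scommute_pos_wa hc (lt_abs_of_mem_dots hj)).smul_right
  have e3 := (SCommute.negFactor_right S hk.le (fun j hj => scommute_neg (n := n) hc hj)).symm
    (neg_qAinv_pow_mul _)
  rw [e1.sandwich e2 e3, mul_comm (w _), map_mul, hw, wa, singleCount]
  congr 1
  ring

theorem scommute_pos_factors (hw : ∀ c, φ (w c) = wa n c) {k : ℕ} (hk : k < n) {g : ℤ → AL} :
    SCommute ((-qA) ^ (singleCount n S k + 2 * (dots n S k).card))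
      (posFactor n S k * φ (∏ c ∈ dots n S k, g c • w (-c)) * negFactor n S k)
      (va n ((n : ℤ) - k)) := by
  have hc : (0 : ℤ) < (n : ℤ) - k := by omega
  have e1 := SCommute.posFactor_right S hk.le (fun j hj => scommute_pos (n := n) hc hj)
  have e2 : SCommute ((qAinv ^ 2) ^ (dots n S k).card) (va n ((n : ℤ) - k))
      (φ (∏ c ∈ dots n S k, g c • w (-c))) := by
    refine SCommute.map_prod φ fun j hj => ?_
    rw [map_smul, hw]
    exact (scommute_pos_wa hc (by rw [abs_neg]; exact lt_abs_of_mem_dots hj)).smul_right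
  have e3 := SCommute.negFactor_right S hk.le (fun j hj => scommute_pos (n := n) hc hj)
  refine (((e1.mul_right e2).mul_right e3).congr ?_).symm (neg_qA_pow_mul _)
  rw [singleCount, pow_add, pow_add, pow_mul, neg_sq]
  ring

theorem scommute_neg_factors (hw : ∀ c, φ (w c) = wa n c) {k : ℕ} (hk : k < n) {g : ℤ → AL} :
    SCommute ((-qA) ^ (singleCount n S k + 2 * (dots n S k).card)) (va n (-((n : ℤ) - k)))
      (posFactor n S k * φ (∏ c ∈ dots n S k, g c • w (-c)) * negFactor n S k) := by
  have hc : (0 : ℤ) < (n : ℤ) - k := by omega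
  have e1 := SCommute.posFactor_right S hk.le (fun j hj => scommute_neg (n := n) hc hj)
  have e2 : SCommute ((qA ^ 2) ^ (dots n S k).card) (va n (-((n : ℤ) - k)))
      (φ (∏ c ∈ dots n S k, g c • w (-c))) := by
    refine SCommute.map_prod φ fun j hj => ?_
    rw [map_smul, hw]
    exact (scommute_neg_wa hc (by rw [abs_neg]; exact lt_abs_of_mem_dots hj)).smul_right
  have e3 := SCommute.negFactor_right S hk.le (fun j hj => scommute_neg (n := n) hc hj)
  refine ((e1.mul_right e2).mul_right e3).congr ?_
  rw [singleCount, pow_add, pow_add, pow_mul, neg_sq]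
  ring

theorem vsetRev_upper_both_step (hw : ∀ c, φ (w c) = wa n c) {k : ℕ} (hk : k < n) {g : ℤ → AL} :
    va n (-((n : ℤ) - k)) *
        (posFactor n S k * φ (∏ c ∈ dots n S k, g c • w (-c)) * negFactor n S k) *
      va n ((n : ℤ) - k) = ((-qA) ^ (singleCount n S k + 2 * (dots n S k).card)) •
      (posFactor n S k * φ (w (-((n : ℤ) - k)) * ∏ c ∈ dots n S k, g c • w (-c)) *
        negFactor n S k) := by
  have hc : (0 : ℤ) < (n : ℤ) - k := by omega
  have e1 := SCommute.posFactor_right S hk.le (fun j hj => scommute_neg (n := n) hc hj)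
  have e2 : SCommute ((qA ^ 2) ^ (dots n S k).card) (va n (-((n : ℤ) - k)))
      (φ (∏ c ∈ dots n S k, g c • w (-c))) := by
    refine SCommute.map_prod φ fun j hj => ?_
    rw [map_smul, hw]
    exact (scommute_neg_wa hc (by rw [abs_neg]; exact lt_abs_of_mem_dots hj)).smul_right
  have e3 := (SCommute.negFactor_right S hk.le (fun j hj => scommute_pos (n := n) hc hj)).symm
    (neg_qA_pow_mul _)
  rw [e1.sandwich e2 e3, mul_comm (w _), map_mul, hw, wa, neg_neg, singleCount]
  congr 1
  rw [pow_add, pow_add, pow_mul (-qA), neg_sq]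
  ring

theorem vset_upper (hw : ∀ c, φ (w c) = wa n c) (hS : S ⊆ Iset n) {k : ℕ} (hk : k ≤ n) :
    vset n (upper n S k) = qAinv ^ ((dots n S k).card * ((dots n S k).card - 1)) •
      (posFactor n S k * φ (∏ c ∈ dots n S k, twist n S c • w c) * negFactor n S k) := by
  induction k with
  | zero => simp [upper_zero hS, dots_zero, vset_empty, posFactor, negFactor]
  | succ k ih =>
    have hk' : k < n := by omega
    have ih := ih hk'.le
    by_cases h1 : (n : ℤ) - k ∈ S <;> by_cases h2 : -((n : ℤ) - k) ∈ S
    · rw [upper_succ_both hk' h1 h2, vset_insert_both hk', ih, dots_succ, if_pos ⟨h1, h2⟩,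
        Finset.prod_insert notMem_dots, Finset.card_insert_of_notMem notMem_dots, twist_col,
        mul_smul_comm, smul_mul_assoc, vset_upper_both_step φ hw hk', smul_mul_assoc, map_smul,
        succ_mul_self, mul_smul_comm, smul_mul_assoc, smul_smul, smul_smul]
      simp only [posFactor, negFactor, h1, h2, not_true_eq_false, and_false, false_and, if_false,
        one_mul, mul_one]
      congr 1
      ring
    · rw [upper_succ_pos hk' h1 h2, vset_insert_col hk', ih, dots_succ,
        if_neg (by simp [-neg_sub, h2])]
      simp [-neg_sub, posFactor, negFactor, h1, h2, mul_assoc]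
    · rw [upper_succ_neg hk' h1 h2, vset_insert_neg_col hk', ih, dots_succ,
        if_neg (by simp [-neg_sub, h1])]
      simp [-neg_sub, posFactor, negFactor, h1, h2, mul_assoc]
    · rw [upper_succ_none hk' h1 h2, ih, dots_succ, if_neg (by simp [-neg_sub, h1])]
      simp [-neg_sub, posFactor, negFactor, h1, h2]

/-- The scalar of the bar map for a monomial of degree `m` with `d` fully dotted columns. -/
def degScalar (m d : ℕ) : AL := (-qAinv) ^ (m * (m - 1) / 2) * qAinv ^ d

theorem degScalar_succ (m d : ℕ) : degScalar (m + 1) d = degScalar m d * (-qAinv) ^ m := by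
  rw [degScalar, degScalar, Nat.triangle_succ, pow_add]
  ring

theorem degScalar_succ_succ (m d : ℕ) :
    degScalar (m + 2) (d + 1) = degScalar m d * ((-qAinv) ^ (2 * m) * (-qAinv ^ 2)) := by
  rw [degScalar, degScalar, Nat.triangle_succ, Nat.triangle_succ, pow_add, pow_add]
  ring

theorem reverse_scalar (m d : ℕ) :
    (-qAinv) ^ (2 * (m + 2 * d)) * (-qAinv ^ 2) *
        qAinv ^ (d * (d - 1)) * (-qA) ^ (m + 2 * d) =
      qAinv ^ (d * (d - 1) + 2 * d) * ((-qAinv) ^ m * (-qAinv ^ 2)) := by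
  have h3 := neg_qAinv_pow_mul (m + 2 * d)
  have h5 : (-qAinv) ^ (m + 2 * d) = (-qAinv) ^ m * qAinv ^ (2 * d) := by
    rw [pow_add, pow_mul (-qAinv), neg_sq, ← pow_mul]
  rw [mul_comm 2 (m + 2 * d), pow_mul, sq (_ ^ (m + 2 * d)), pow_add qAinv]
  linear_combination (-qAinv) ^ (m + 2 * d) * (-qAinv ^ 2) * qAinv ^ (d * (d - 1)) * h3 +
    (-qAinv ^ 2) * qAinv ^ (d * (d - 1)) * h5

theorem vsetRev_upper (hw : ∀ c, φ (w c) = wa n c) (hS : S ⊆ Iset n) {k : ℕ} (hk : k ≤ n) :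
    degScalar (singleCount n S k + 2 * (dots n S k).card) (dots n S k).card •
        vsetRev n (upper n S k) =
      qAinv ^ ((dots n S k).card * ((dots n S k).card - 1)) •
      (posFactor n S k * φ (∏ c ∈ dots n S k, (twist n S c * (-qAinv ^ 2)) • w (-c)) *
        negFactor n S k) := by
  induction k with
  | zero =>
    simp [upper_zero hS, dots_zero, vsetRev_empty, posFactor, negFactor, singleCount, posCount,
      negCount, degScalar]
  | succ k ih =>
    have hk' : k < n := by omega
    have ih := ih hk'.le
    by_cases h1 : (n : ℤ) - k ∈ S <;> by_cases h2 : -((n : ℤ) - k) ∈ S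
    · have hs : singleCount n S (k + 1) = singleCount n S k := by
        simp [-neg_sub, singleCount, posCount, negCount, h1, h2]
      rw [upper_succ_both hk' h1 h2, vsetRev_insert_both hk', dots_succ, if_pos ⟨h1, h2⟩,
        Finset.prod_insert notMem_dots, Finset.card_insert_of_notMem notMem_dots, twist_col, hs,
        mul_add, ← add_assoc, mul_one, degScalar_succ_succ, mul_comm (degScalar _ _), mul_smul,
        ← smul_mul_assoc (degScalar _ _), ← mul_smul_comm (degScalar _ _), ih,
        mul_smul_comm, smul_mul_assoc, vsetRev_upper_both_step φ hw hk', smul_mul_assoc, map_smul,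
        succ_mul_self, mul_smul_comm, smul_mul_assoc, smul_smul, smul_smul, smul_smul]
      simp only [posFactor, negFactor, h1, h2, not_true_eq_false, and_false, false_and, if_false,
        one_mul, mul_one]
      rw [reverse_scalar]
    · have hs : singleCount n S (k + 1) = singleCount n S k + 1 := by
        simp [-neg_sub, singleCount, posCount, negCount, h1, h2]; omega
      have hc := scommute_pos_factors (S := S) φ hw hk' (g := fun c => twist n S c * (-qAinv ^ 2))
      rw [upper_succ_pos hk' h1 h2, vsetRev_insert_col hk', dots_succ,
        if_neg (by simp [-neg_sub, h2]), hs, add_right_comm, degScalar_succ,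
        mul_comm (degScalar _ _), mul_smul, ← smul_mul_assoc, ih, smul_mul_assoc, hc, smul_smul,
        smul_smul, mul_right_comm, neg_qAinv_pow_mul, one_mul]
      simp [-neg_sub, posFactor, negFactor, h1, h2, mul_assoc]
    · have hs : singleCount n S (k + 1) = singleCount n S k + 1 := by
        simp [-neg_sub, singleCount, posCount, negCount, h1, h2]; omega
      have hc := scommute_neg_factors (S := S) φ hw hk' (g := fun c => twist n S c * (-qAinv ^ 2))
      rw [upper_succ_neg hk' h1 h2, vsetRev_insert_neg_col hk', dots_succ,
        if_neg (by simp [-neg_sub, h1]), hs, add_right_comm, degScalar_succ,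
        mul_comm (degScalar _ _), mul_smul, ← mul_smul_comm, ih, mul_smul_comm, hc, smul_smul,
        smul_smul, mul_right_comm, neg_qAinv_pow_mul, one_mul]
      simp [-neg_sub, posFactor, negFactor, h1, h2, mul_assoc]
    · have hs : singleCount n S (k + 1) = singleCount n S k := by
        simp [-neg_sub, singleCount, posCount, negCount, h1, h2]
      rw [upper_succ_none hk' h1 h2, dots_succ, if_neg (by simp [-neg_sub, h1]), hs, ih]
      simp [-neg_sub, posFactor, negFactor, h1, h2]

end Factor

section Scalars

variable {n : ℕ} {S : Finset ℤ}

theorem card_upper (hS : S ⊆ Iset n) {k : ℕ} (hk : k ≤ n) :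
    (upper n S k).card = singleCount n S k + 2 * (dots n S k).card := by
  induction k with
  | zero => simp [upper_zero hS, dots_zero, singleCount, posCount, negCount]
  | succ k ih =>
    have hk' : k < n := by omega
    have ih := ih hk'.le
    rw [singleCount] at ih
    by_cases h1 : (n : ℤ) - k ∈ S <;> by_cases h2 : -((n : ℤ) - k) ∈ S
    · rw [upper_succ_both hk' h1 h2, Finset.card_insert_of_notMem (col_notMem_insert hk'),
        Finset.card_insert_of_notMem (col_notMem_upper hk').2, dots_succ, if_pos ⟨h1, h2⟩,
        Finset.card_insert_of_notMem notMem_dots, ih]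
      simp [-neg_sub, singleCount, posCount, negCount, h1, h2]
      omega
    · rw [upper_succ_pos hk' h1 h2, Finset.card_insert_of_notMem (col_notMem_upper hk').1,
        dots_succ, if_neg (by simp [-neg_sub, h2]), ih]
      simp [-neg_sub, singleCount, posCount, negCount, h1, h2]
      omega
    · rw [upper_succ_neg hk' h1 h2, Finset.card_insert_of_notMem (col_notMem_upper hk').2,
        dots_succ, if_neg (by simp [-neg_sub, h1]), ih]
      simp [-neg_sub, singleCount, posCount, negCount, h1, h2]
      omega
    · rw [upper_succ_none hk' h1 h2, dots_succ, if_neg (by simp [-neg_sub, h1]), ih]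
      simp [-neg_sub, singleCount, posCount, negCount, h1, h2]

theorem mem_negSet {S : Finset ℤ} {x : ℤ} : x ∈ negSet S ↔ -x ∈ S := by
  simp only [negSet, Finset.mem_image]
  exact ⟨by rintro ⟨a, ha, rfl⟩; rwa [neg_neg], fun h => ⟨-x, h, neg_neg x⟩⟩

theorem mem_pmSet {S : Finset ℤ} {x : ℤ} : x ∈ pmSet S ↔ x ∈ S ∨ -x ∈ S := by
  rw [pmSet, Finset.mem_union, mem_negSet]

theorem mem_dots_self {x : ℤ} : x ∈ dots n S n ↔ 0 < x ∧ x ≤ n ∧ x ∈ S ∧ -x ∈ S := by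
  simp [dots, and_assoc]

theorem card_inter_negSet (hS : S ⊆ Iset n) :
    (S ∩ negSet S).card / 2 = (dots n S n).card := by
  have h : S ∩ negSet S = dots n S n ∪ negSet (dots n S n) := by
    ext x
    simp only [Finset.mem_inter, Finset.mem_union, mem_negSet, mem_dots_self, neg_neg]
    constructor
    · rintro ⟨h1, h2⟩
      have := mem_Iset.1 (hS h1)
      rcases lt_or_gt_of_ne this.1 with h | h
      · exact Or.inr ⟨by omega, by omega, h2, h1⟩
      · exact Or.inl ⟨h, this.2.2, h1, h2⟩
    · rintro (⟨_, _, h1, h2⟩ | ⟨_, _, h1, h2⟩)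
      · exact ⟨h1, h2⟩
      · exact ⟨h2, h1⟩
  have hd : Disjoint (dots n S n) (negSet (dots n S n)) := by
    rw [Finset.disjoint_left]
    intro x hx hx'
    rw [mem_negSet] at hx'
    have h1 := (mem_dots_self.1 hx).1
    have h2 := (mem_dots_self.1 hx').1
    omega
  rw [h, Finset.card_union_of_disjoint hd, negSet, Finset.card_image_of_injective _ neg_injective]
  omega

theorem barScalar_eq (hS : S ⊆ Iset n) :
    barScalar S =
      degScalar (singleCount n S n + 2 * (dots n S n).card) (dots n S n).card := by
  have h := card_upper hS le_rfl
  rw [upper_self hS] at h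
  rw [barScalar, degScalar, card_inter_negSet hS, h, qAinv, LaurentPolynomial.T_pow]
  congr 2
  ring

theorem posFactor_mul_wa {t : ℤ} (h1 : t ∈ S) (h2 : -t ∉ S) {k : ℕ} (hk : k ≤ n)
    (ht : (n : ℤ) - k < t) (htn : t ≤ n) : posFactor n S k * wa n t = 0 := by
  induction k with
  | zero => simp at ht; omega
  | succ k ih =>
    rw [posFactor, mul_assoc]
    by_cases h : (n : ℤ) - k < t
    · rw [ih (by omega) h, mul_zero]
    · obtain rfl : t = (n : ℤ) - k := by push_cast at ht; omega
      have hc : (0 : ℤ) < (n : ℤ) - k := by omega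
      have e1 : va n ((n : ℤ) - k) * posFactor n S k = _ :=
        SCommute.posFactor_right S (by omega) (fun j hj => scommute_pos (n := n) hc hj)
      rw [if_pos ⟨h1, h2⟩, ← mul_assoc, e1, smul_mul_assoc, mul_assoc, wa, ← mul_assoc (va n _),
        va_mul_self, zero_mul, mul_zero, smul_zero]

theorem wa_mul_negFactor {t : ℤ} (h1 : t ∉ S) (h2 : -t ∈ S) {k : ℕ} (hk : k ≤ n)
    (ht : (n : ℤ) - k < t) (htn : t ≤ n) : wa n t * negFactor n S k = 0 := by
  induction k with
  | zero => simp at ht; omega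
  | succ k ih =>
    rw [negFactor, ← mul_assoc]
    by_cases h : (n : ℤ) - k < t
    · rw [ih (by omega) h, zero_mul]
    · obtain rfl : t = (n : ℤ) - k := by push_cast at ht; omega
      have hc : (0 : ℤ) < (n : ℤ) - k := by omega
      have e1 : negFactor n S k * va n (-((n : ℤ) - k)) = _ :=
        (SCommute.negFactor_right S (by omega) (fun j hj => scommute_neg (n := n) hc hj)).symm
          (neg_qAinv_pow_mul _)
      rw [if_pos ⟨h1, h2⟩, mul_assoc, e1, mul_smul_comm, ← mul_assoc, wa, mul_assoc (va n _),
        va_mul_self, mul_zero, zero_mul, smul_zero]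

theorem posFactor_congr {S' : Finset ℤ} (h : ∀ c : ℤ, 0 < c → c ≤ n →
    ((c ∈ S ∧ -c ∉ S) ↔ (c ∈ S' ∧ -c ∉ S'))) {k : ℕ} (hk : k ≤ n) :
    posFactor n S k = posFactor n S' k ∧ posCount n S k = posCount n S' k := by
  induction k with
  | zero => exact ⟨rfl, rfl⟩
  | succ k ih =>
    simp only [posFactor, posCount, h ((n : ℤ) - k) (by omega) (by omega), ih (by omega), and_self]

theorem negFactor_congr {S' : Finset ℤ} (h : ∀ c : ℤ, 0 < c → c ≤ n →
    ((c ∉ S ∧ -c ∈ S) ↔ (c ∉ S' ∧ -c ∈ S'))) {k : ℕ} (hk : k ≤ n) :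
    negFactor n S k = negFactor n S' k ∧ negCount n S k = negCount n S' k := by
  induction k with
  | zero => exact ⟨rfl, rfl⟩
  | succ k ih =>
    simp only [negFactor, negCount, h ((n : ℤ) - k) (by omega) (by omega), ih (by omega), and_self]

end Scalars

/-- The tail sums `y_c = ∑_{j ≥ c} (-q)^{j-c} w_j`. -/
def tailSum {W : Type} [CommRing W] [Algebra AL W] (n : ℕ) (w : ℤ → W) (c : ℕ) : W :=
  ∑ k ∈ Finset.range (n + 1 - c), (-qA) ^ k • w ((c + k : ℕ) : ℤ)

section TailSum

variable {n : ℕ} {W : Type} [CommRing W] [Algebra AL W]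

theorem tailSum_last (w : ℤ → W) : tailSum n w (n + 1) = 0 := by simp [tailSum]

theorem eq_tailSum_add (w : ℤ → W) {c : ℕ} (hc : c ≤ n) :
    w c = tailSum n w c + qA • tailSum n w (c + 1) := by
  have h : n + 1 - c = (n - c) + 1 := by omega
  have h' : n + 1 - (c + 1) = n - c := by omega
  rw [tailSum, tailSum, h, h', Finset.sum_range_succ', Finset.smul_sum, add_right_comm,
    ← Finset.sum_add_distrib, Finset.sum_eq_zero]
  · simp
  · intro k _
    rw [smul_smul, add_right_comm c 1 k, add_assoc c k 1, pow_succ, mul_neg, neg_smul,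
      mul_comm, neg_add_cancel]

theorem neg_eq_tailSum_add {φ : W →ₐ[AL] LamAlg n} (hφ : Function.Injective φ) {w : ℤ → W}
    (hw : ∀ c, φ (w c) = wa n c) {c : ℕ} (hc1 : 1 ≤ c) (hc : c ≤ n) :
    w (-c) = (-qA ^ 2) • (tailSum n w c + qAinv • tailSum n w (c + 1)) := by
  have h1 : w (-c) = (-(qA ^ 2)) • w c + (qA - qAinv) • (qA ^ 2 • tailSum n w (c + 1)) := by
    apply hφ
    have h' : n + 1 - (c + 1) = n - c := by omega
    simp only [map_add, map_smul, hw, tailSum, map_sum, h', Finset.smul_sum]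
    rw [wa, neg_neg, va_main c hc1 hc, Finset.smul_sum]
    congr 1
    refine Finset.sum_nbij' (fun k => k - 1) (fun k => k + 1) ?_ ?_ ?_ ?_ ?_
    · intro k hk
      simp only [Finset.mem_Icc, Finset.mem_range] at hk ⊢
      omega
    · intro k hk
      simp only [Finset.mem_Icc, Finset.mem_range] at hk ⊢
      omega
    · intro k hk
      simp only [Finset.mem_Icc] at hk
      omega
    · intro k _
      rfl
    · intro k hk
      obtain ⟨m, rfl⟩ : ∃ m, k = m + 1 := ⟨k - 1, by rw [Finset.mem_Icc] at hk; omega⟩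
      rw [Nat.add_sub_cancel, smul_smul (qA ^ 2), add_right_comm c 1 m, ← add_assoc c m 1, wa]
      congr 2
      ring
  rw [h1, eq_tailSum_add w hc, smul_add, smul_add, smul_smul, smul_smul, smul_smul, add_assoc,
    ← add_smul]
  congr 2
  linear_combination (-qA) * qA_mul_qAinv + qA * qA_mul_qAinv

end TailSum

/-- The state of the matching algorithm after processing the columns `n, …, n-k+1`. -/
def matchState (n : ℕ) (S : Finset ℤ) : ℕ → (ℤ → ℤ) × Finset ℤ
  | 0 => (id, ∅)
  | k + 1 => stepCol S ((n : ℤ) - k) (matchState n S k)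

theorem matchData_eq (n : ℕ) (S : Finset ℤ) : matchData n S = matchState n S n := by
  have h : ∀ k : ℕ, ((List.range k).map (fun t : ℕ => (n : ℤ) - t)).foldl
      (fun p x => stepCol S x p) (id, ∅) = matchState n S k := by
    intro k
    induction k with
    | zero => rfl
    | succ k ih => rw [List.range_succ, List.map_append, List.foldl_append, ih]; rfl
  have hl : (do let a ← List.range n; pure (a : ℤ)) = (List.range n).map (fun a : ℕ => (a : ℤ)) :=
    List.flatMap_pure_eq_map _ _
  rw [← h n, matchData, hl, List.map_map]
  rfl

section Fold

variable {n : ℕ} {S : Finset ℤ}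

theorem matchState_free {k : ℕ} : ∀ u ∈ (matchState n S k).2,
    (n : ℤ) - k < u ∧ u ≤ n ∧ u ∉ S ∧ -u ∉ S := by
  induction k with
  | zero => simp [matchState]
  | succ k ih =>
    intro u hu
    have key : u ∈ (matchState n S k).2 ∨ (u = (n : ℤ) - k ∧ u ∉ S ∧ -u ∉ S) := by
      rw [matchState, stepCol] at hu
      split_ifs at hu with h1 h2 h3
      · exact Or.inl (Finset.mem_of_mem_erase hu)
      · exact Or.inl hu
      · rcases Finset.mem_insert.1 hu with rfl | h
        · exact Or.inr ⟨rfl, h3⟩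
        · exact Or.inl h
      · exact Or.inl hu
    rcases key with h | ⟨rfl, h⟩
    · have := ih u h
      exact ⟨by push_cast; omega, this.2⟩
    · exact ⟨by push_cast; omega, by omega, h⟩

theorem matchState_matched {k : ℕ} : ∀ x ∈ dots n S k, (matchState n S k).1 x ≠ x →
    ((n : ℤ) - k < (matchState n S k).1 x ∧ (matchState n S k).1 x ≤ n ∧
      (matchState n S k).1 x ∉ S ∧ -(matchState n S k).1 x ∉ S ∧
      (matchState n S k).1 x ∉ (matchState n S k).2) ∧
    ∀ z ∈ dots n S k, (matchState n S k).1 z ≠ z →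
      (matchState n S k).1 x = (matchState n S k).1 z → x = z := by
  induction k with
  | zero => simp [dots_zero]
  | succ k ih =>
    by_cases h : (n : ℤ) - k ∈ S ∧ -((n : ℤ) - k) ∈ S
    · rw [dots_succ, if_pos h]
      have hne : ∀ x ∈ dots n S k, x ≠ (n : ℤ) - k :=
        fun x hx => ne_of_mem_of_not_mem hx notMem_dots
      by_cases hU : (matchState n S k).2.Nonempty
      · have hm := Finset.min'_mem _ hU
        have hst : matchState n S (k + 1) =
            (Function.update (matchState n S k).1 ((n : ℤ) - k) ((matchState n S k).2.min' hU),
              (matchState n S k).2.erase ((matchState n S k).2.min' hU)) := by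
          rw [matchState, stepCol, if_pos h, dif_pos hU]
        have hf := matchState_free _ hm
        intro x hx hxx
        rw [hst] at hxx ⊢
        simp only at hxx ⊢
        rcases Finset.mem_insert.1 hx with rfl | hx
        · rw [Function.update_self]
          refine ⟨⟨by push_cast; omega, hf.2.1, hf.2.2.1, hf.2.2.2, by simp⟩, ?_⟩
          intro z hz hzz he
          rcases Finset.mem_insert.1 hz with rfl | hz
          · rfl
          · rw [Function.update_of_ne (hne z hz)] at hzz he
            exact absurd (he ▸ hm) (ih z hz hzz).1.2.2.2.2
        · rw [Function.update_of_ne (hne x hx)] at hxx ⊢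
          have h1 := ih x hx hxx
          refine ⟨⟨by push_cast; omega, h1.1.2.1, h1.1.2.2.1, h1.1.2.2.2.1,
            fun h => h1.1.2.2.2.2 (Finset.mem_of_mem_erase h)⟩, ?_⟩
          intro z hz hzz he
          rcases Finset.mem_insert.1 hz with rfl | hz
          · rw [Function.update_self] at he
            exact absurd (he ▸ hm) h1.1.2.2.2.2
          · rw [Function.update_of_ne (hne z hz)] at hzz he
            exact h1.2 z hz hzz he
      · have hst : matchState n S (k + 1) =
            (Function.update (matchState n S k).1 ((n : ℤ) - k) ((n : ℤ) - k),
              (matchState n S k).2) := by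
          rw [matchState, stepCol, if_pos h, dif_neg hU]
        intro x hx hxx
        rw [hst] at hxx ⊢
        simp only at hxx ⊢
        rcases Finset.mem_insert.1 hx with rfl | hx
        · simp at hxx
        · rw [Function.update_of_ne (hne x hx)] at hxx ⊢
          have h1 := ih x hx hxx
          refine ⟨⟨by push_cast; omega, h1.1.2⟩, ?_⟩
          intro z hz hzz he
          rcases Finset.mem_insert.1 hz with rfl | hz
          · simp at hzz
          · rw [Function.update_of_ne (hne z hz)] at hzz he
            exact h1.2 z hz hzz he
    · rw [dots_succ, if_neg h]
      have hst : (matchState n S (k + 1)).1 = (matchState n S k).1 ∧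
          ((matchState n S (k + 1)).2 ⊆ insert ((n : ℤ) - k) (matchState n S k).2) := by
        rw [matchState, stepCol, if_neg h]
        split_ifs
        · exact ⟨rfl, subset_rfl⟩
        · exact ⟨rfl, Finset.subset_insert _ _⟩
      intro x hx hxx
      rw [hst.1] at hxx ⊢
      have h1 := ih x hx hxx
      refine ⟨⟨by push_cast; omega, h1.1.2.1, h1.1.2.2.1, h1.1.2.2.2.1, fun h => ?_⟩, h1.2⟩
      rcases Finset.mem_insert.1 (hst.2 h) with h | h
      · omega
      · exact h1.1.2.2.2.2 h

variable {Q : Type} [CommRing Q] (y : ℤ → Q)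

/-- The factor of the canonical basis vector at a fully dotted column `x` matched to `f x`. -/
def pairFactor (q q' : Q) (f : ℤ → ℤ) (x : ℤ) : Q :=
  if f x = x then y x + q * y (x + 1)
  else (y x + q * y (x + 1)) + q' * (y (f x) + q * y (f x + 1))

theorem prod_pairFactor_update (q q' : Q) (f : ℤ → ℤ) (k : ℕ) (b : ℤ) :
    ∏ x ∈ dots n S k, pairFactor y q q' (Function.update f ((n : ℤ) - k) b) x =
      ∏ x ∈ dots n S k, pairFactor y q q' f x := by
  refine Finset.prod_congr rfl fun x hx => ?_
  rw [pairFactor, pairFactor, Function.update_of_ne (ne_of_mem_of_not_mem hx notMem_dots)]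

theorem prod_pairFactor_chain {q q' : Q} (hq : q * q' = 1) (hend : y (n + 1) = 0)
    (hsingle : ∀ c : ℤ, 0 < c → c ≤ n → ¬ (c ∈ S ↔ -c ∈ S) → y c = y (c + 1))
    (hrel : ∀ c : ℤ, 0 < c → c ≤ n → (c ∈ S ↔ -c ∈ S) →
      (y c + q * y (c + 1)) * (y c + q' * y (c + 1)) = 0) {k : ℕ} (hk : k ≤ n) :
    ∏ x ∈ dots n S k, pairFactor y q q' (matchState n S k).1 x =
      ∏ x ∈ dots n S k, pairFactor y q' q (matchState n S k).1 x ∧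
    ∀ a b : ℤ, (a = (n : ℤ) - k + 1 ∨ a - 1 ∈ (matchState n S k).2) →
      b ∈ insert ((n : ℤ) + 1) (matchState n S k).2 → a ≤ b →
      (∀ u ∈ (matchState n S k).2, a ≤ u → b ≤ u) →
      (∏ x ∈ dots n S k, pairFactor y q q' (matchState n S k).1 x) * y a =
        (∏ x ∈ dots n S k, pairFactor y q q' (matchState n S k).1 x) * y b := by
  induction k with
  | zero =>
    refine ⟨by simp [dots_zero], fun a b ha hb _ _ => ?_⟩
    simp only [matchState, Finset.notMem_empty, or_false, Finset.mem_insert] at ha hb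
    rw [hb, ha]; simp
  | succ k ih =>
    obtain ⟨hsym, hch⟩ := ih (by omega)
    have hfree := matchState_free (n := n) (S := S) (k := k)
    have hx0 : (0 : ℤ) < (n : ℤ) - k := by omega
    have hxn : (n : ℤ) - k ≤ n := by omega
    have hcast : (n : ℤ) - (k + 1 : ℕ) + 1 = (n : ℤ) - k := by push_cast; ring
    rw [hcast]
    by_cases h : (n : ℤ) - k ∈ S ∧ -((n : ℤ) - k) ∈ S
    · have hr := hrel _ hx0 hxn (by tauto)
      rw [dots_succ, if_pos h, Finset.prod_insert notMem_dots, Finset.prod_insert notMem_dots]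
      by_cases hU : (matchState n S k).2.Nonempty
      · set m := (matchState n S k).2.min' hU with hmdef
        have hm := Finset.min'_mem _ hU
        rw [← hmdef] at hm
        have hle : ∀ u ∈ (matchState n S k).2, m ≤ u := fun u hu => Finset.min'_le _ _ hu
        have hst : matchState n S (k + 1) =
            (Function.update (matchState n S k).1 ((n : ℤ) - k) m,
              (matchState n S k).2.erase m) := by
          rw [matchState, stepCol, if_pos h, dif_pos hU]
        have hf := hfree _ hm
        have hrm := hrel m (by omega) hf.2.1 (by tauto)
        have e1 := hch ((n : ℤ) - k + 1) m (Or.inl rfl) (Finset.mem_insert_of_mem hm) (by omega)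
          (fun u hu _ => hle u hu)
        have hG : ∀ r r' : Q, pairFactor y r r'
            (Function.update (matchState n S k).1 ((n : ℤ) - k) m) ((n : ℤ) - k) =
            (y ((n : ℤ) - k) + r * y ((n : ℤ) - k + 1)) + r' * (y m + r * y (m + 1)) := by
          intro r r'
          rw [pairFactor, Function.update_self, if_neg (by omega)]
        rw [hst]
        simp only [prod_pairFactor_update, hG]
        rw [← hsym]
        generalize (∏ x ∈ dots n S k, pairFactor y q q' (matchState n S k).1 x) = P at *
        refine ⟨by linear_combination (q - q') * e1, fun a b ha hb hab hmin => ?_⟩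
        rcases ha with rfl | ha
        · have e2 := hch (m + 1) b (Or.inr (by simpa using hm))
            (Finset.insert_subset_insert _ (Finset.erase_subset _ _) hb)
            (by
              rcases Finset.mem_insert.1 hb with rfl | hb
              · omega
              · have := hle b (Finset.mem_of_mem_erase hb)
                have := Finset.ne_of_mem_erase hb
                omega)
            (fun u hu hmu => hmin u (Finset.mem_erase.2 ⟨by omega, hu⟩)
              (by have := hfree u hu; omega))
          linear_combination P * hr - P * hrm + (-(y m + y ((n : ℤ) - k + 1)) -
            q' * y ((n : ℤ) - k) - q * y (m + 1)) * e1 +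
            P * (y ((n : ℤ) - k) * y (m + 1) - y ((n : ℤ) - k + 1) ^ 2) * hq +
            ((y ((n : ℤ) - k) + q * y ((n : ℤ) - k + 1)) + q' * (y m + q * y (m + 1))) * e2
        · have e2 := hch a b (Or.inr (Finset.mem_of_mem_erase ha))
            (Finset.insert_subset_insert _ (Finset.erase_subset _ _) hb) hab
            (fun u hu hau => hmin u (Finset.mem_erase.2 ⟨by
              have := hle _ (Finset.mem_of_mem_erase ha)
              omega, hu⟩) hau)
          linear_combination ((y ((n : ℤ) - k) + q * y ((n : ℤ) - k + 1)) +
            q' * (y m + q * y (m + 1))) * e2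
      · have hst : matchState n S (k + 1) =
            (Function.update (matchState n S k).1 ((n : ℤ) - k) ((n : ℤ) - k),
              (matchState n S k).2) := by
          rw [matchState, stepCol, if_pos h, dif_neg hU]
        have hU' := Finset.not_nonempty_iff_eq_empty.1 hU
        have e1 := hch ((n : ℤ) - k + 1) (n + 1) (Or.inl rfl) (by simp) (by omega)
          (by simp [hU'])
        have hG : ∀ r r' : Q, pairFactor y r r'
            (Function.update (matchState n S k).1 ((n : ℤ) - k) ((n : ℤ) - k)) ((n : ℤ) - k) =
            y ((n : ℤ) - k) + r * y ((n : ℤ) - k + 1) := by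
          intro r r'
          rw [pairFactor, Function.update_self, if_pos rfl]
        rw [hst]
        simp only [prod_pairFactor_update, hG]
        rw [← hsym]
        generalize (∏ x ∈ dots n S k, pairFactor y q q' (matchState n S k).1 x) = P at *
        rw [hend] at e1
        refine ⟨by linear_combination (q - q') * e1, fun a b ha hb hab hmin => ?_⟩
        rw [hU'] at ha hb
        simp only [Finset.notMem_empty, or_false, Finset.mem_insert] at ha hb
        subst ha hb
        rw [hend]
        linear_combination P * hr - (q' * y ((n : ℤ) - k) + q * q' * y ((n : ℤ) - k + 1)) * e1
    · rw [dots_succ, if_neg h]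
      by_cases h2 : (n : ℤ) - k ∉ S ∧ -((n : ℤ) - k) ∉ S
      · have hst : matchState n S (k + 1) =
            ((matchState n S k).1, insert ((n : ℤ) - k) (matchState n S k).2) := by
          rw [matchState, stepCol, if_neg h, if_pos h2]
        rw [hst]
        refine ⟨hsym, fun a b ha hb hab hmin => ?_⟩
        simp only [Finset.mem_insert] at ha hb hmin
        by_cases hba : b = a
        · rw [hba]
        have ha' : a = (n : ℤ) - k + 1 ∨ a - 1 ∈ (matchState n S k).2 := by
          rcases ha with rfl | ha | ha
          · have h3 := hmin _ (Or.inl rfl) le_rfl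
            omega
          · exact Or.inl (by omega)
          · exact Or.inr ha
        have hax : (n : ℤ) - k < a := by
          rcases ha' with h | h
          · omega
          · have := hfree _ h; omega
        refine hch a b ha' ?_ hab (fun u hu => hmin u (Or.inr hu))
        rw [Finset.mem_insert]
        rcases hb with hb | hb | hb
        · exact Or.inl hb
        · omega
        · exact Or.inr hb
      · have hst : matchState n S (k + 1) = matchState n S k := by
          rw [matchState, stepCol, if_neg h, if_neg h2]
        rw [hst]
        refine ⟨hsym, fun a b ha hb hab hmin => ?_⟩
        rcases ha with rfl | ha
        · rw [hsingle _ hx0 hxn (by tauto)]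
          refine hch _ b (Or.inl rfl) hb ?_ (fun u hu hau => hmin u hu (by omega))
          rcases Finset.mem_insert.1 hb with rfl | hb
          · omega
          · have := hfree _ hb; omega
        · exact hch a b (Or.inr ha) hb hab hmin

end Fold

section Exchange

variable {n : ℕ} {S X : Finset ℤ}

theorem mem_LSet {x : ℤ} : x ∈ LSet n S ↔ x ∈ dots n S n ∧ matchCol n S x ≠ x := by
  simp only [LSet, Finset.mem_filter, Finset.mem_Icc, mem_dots_self]
  constructor
  · rintro ⟨⟨h1, h2⟩, h3, h4, h5⟩
    exact ⟨⟨by omega, h2, h3, h4⟩, h5⟩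
  · rintro ⟨⟨h1, h2, h3, h4⟩, h5⟩
    exact ⟨⟨by omega, h2⟩, h3, h4, h5⟩

theorem LSet_eq_filter : LSet n S = (dots n S n).filter (fun x => matchCol n S x ≠ x) := by
  ext x
  rw [mem_LSet, Finset.mem_filter]

theorem matchCol_eq (x : ℤ) : matchCol n S x = (matchState n S n).1 x := by
  rw [matchCol, matchData_eq]

theorem matchCol_free {x : ℤ} (hx : x ∈ LSet n S) :
    0 < matchCol n S x ∧ matchCol n S x ≤ n ∧ matchCol n S x ∉ S ∧ -matchCol n S x ∉ S := by
  obtain ⟨h1, h2⟩ := mem_LSet.1 hx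
  rw [matchCol_eq] at h2 ⊢
  have := (matchState_matched x h1 h2).1
  exact ⟨by omega, this.2.1, this.2.2.1, this.2.2.2.1⟩

theorem matchCol_injOn : Set.InjOn (matchCol n S) (LSet n S) := by
  intro x hx z hz h
  obtain ⟨h1, h2⟩ := mem_LSet.1 hx
  obtain ⟨h3, h4⟩ := mem_LSet.1 hz
  rw [matchCol_eq] at h2 h4
  rw [matchCol_eq, matchCol_eq] at h
  exact (matchState_matched x h1 h2).2 z h3 h4 h

theorem mem_exchange (hX : X ⊆ LSet n S) {c : ℤ} (hc : 0 < c) :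
    (c ∈ (S \ pmSet X) ∪ pmSet (X.image (matchCol n S)) ↔
      (c ∈ S ∧ c ∉ X) ∨ c ∈ X.image (matchCol n S)) ∧
    (-c ∈ (S \ pmSet X) ∪ pmSet (X.image (matchCol n S)) ↔
      (-c ∈ S ∧ c ∉ X) ∨ c ∈ X.image (matchCol n S)) := by
  have h1 : -c ∉ X := fun h => by
    have := (mem_dots_self.1 (mem_LSet.1 (hX h)).1).1
    omega
  have h2 : -c ∉ X.image (matchCol n S) := fun h => by
    obtain ⟨x, hx, h⟩ := Finset.mem_image.1 h
    have := (matchCol_free (hX hx)).1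
    omega
  simp only [Finset.mem_union, Finset.mem_sdiff, mem_pmSet, neg_neg, h1, h2, or_false, false_or,
    and_self]

theorem free_of_mem_image (hX : X ⊆ LSet n S) {c : ℤ} (hc : c ∈ X.image (matchCol n S)) :
    0 < c ∧ c ≤ n ∧ c ∉ S ∧ -c ∉ S := by
  obtain ⟨x, hx, rfl⟩ := Finset.mem_image.1 hc
  exact matchCol_free (hX hx)

theorem dotted_of_mem (hX : X ⊆ LSet n S) {c : ℤ} (hc : c ∈ X) :
    0 < c ∧ c ≤ n ∧ c ∈ S ∧ -c ∈ S :=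
  mem_dots_self.1 (mem_LSet.1 (hX hc)).1

theorem exchange_subset (hS : S ⊆ Iset n) (hX : X ⊆ LSet n S) :
    (S \ pmSet X) ∪ pmSet (X.image (matchCol n S)) ⊆ Iset n := by
  intro c hc
  rw [Finset.mem_union, mem_pmSet] at hc
  rcases hc with hc | hc | hc
  · exact hS (Finset.sdiff_subset hc)
  · have := free_of_mem_image hX hc
    rw [mem_Iset]; omega
  · have := free_of_mem_image hX hc
    rw [mem_Iset]; omega

theorem exchange_single_iff (hX : X ⊆ LSet n S) {c : ℤ} (hc : 0 < c) :
    ((c ∈ S ∧ -c ∉ S) ↔ (c ∈ (S \ pmSet X) ∪ pmSet (X.image (matchCol n S)) ∧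
      -c ∉ (S \ pmSet X) ∪ pmSet (X.image (matchCol n S)))) ∧
    ((c ∉ S ∧ -c ∈ S) ↔ (c ∉ (S \ pmSet X) ∪ pmSet (X.image (matchCol n S)) ∧
      -c ∈ (S \ pmSet X) ∪ pmSet (X.image (matchCol n S)))) := by
  rw [(mem_exchange hX hc).1, (mem_exchange hX hc).2]
  have h1 := free_of_mem_image hX (c := c)
  have h2 := dotted_of_mem hX (c := c)
  tauto

theorem dots_exchange (hX : X ⊆ LSet n S) :
    dots n ((S \ pmSet X) ∪ pmSet (X.image (matchCol n S))) n =
      (dots n S n \ X) ∪ X.image (matchCol n S) := by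
  ext c
  rw [Finset.mem_union, Finset.mem_sdiff, mem_dots_self, mem_dots_self]
  have h1 := free_of_mem_image hX (c := c)
  by_cases hc : 0 < c
  · rw [(mem_exchange hX hc).1, (mem_exchange hX hc).2]
    tauto
  · tauto

theorem disjoint_image (hX : X ⊆ LSet n S) :
    Disjoint (dots n S n \ X) (X.image (matchCol n S)) := by
  rw [Finset.disjoint_left]
  intro c hc hc'
  exact (free_of_mem_image hX hc').2.2.1
    (mem_dots_self.1 (Finset.sdiff_subset hc)).2.2.1

theorem card_exchange (hX : X ⊆ LSet n S) :
    ((dots n S n \ X) ∪ X.image (matchCol n S)).card = (dots n S n).card := by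
  have hXD : X ⊆ dots n S n := fun x hx => (mem_LSet.1 (hX hx)).1
  rw [Finset.card_union_of_disjoint (disjoint_image hX), Finset.card_sdiff_of_subset hXD,
    Finset.card_image_of_injOn (matchCol_injOn.mono hX)]
  have := Finset.card_le_card hXD
  omega

theorem sum_exchange {W : Type} [CommRing W] (r : W) (g : ℤ → W) :
    ∑ X ∈ (LSet n S).powerset,
      r ^ X.card * ∏ c ∈ (dots n S n \ X) ∪ X.image (matchCol n S), g c =
    ∏ x ∈ dots n S n, (if matchCol n S x = x then g x else g x + r * g (matchCol n S x)) := by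
  rw [← Finset.prod_filter_mul_prod_filter_not (dots n S n) (fun x => matchCol n S x = x),
    ← LSet_eq_filter, Finset.prod_congr rfl
      (fun x hx => if_pos (Finset.mem_filter.1 hx).2),
    Finset.prod_congr rfl (fun x hx => if_neg (mem_LSet.1 hx).2)]
  simp only [add_comm (g _)]
  rw [Finset.prod_add, Finset.mul_sum]
  refine Finset.sum_congr rfl fun X hX => ?_
  rw [Finset.mem_powerset] at hX
  have hD : dots n S n \ X =
      (dots n S n).filter (fun x => matchCol n S x = x) ∪ (LSet n S \ X) := by
    ext x
    have := @hX x
    simp only [mem_LSet, Finset.mem_union, Finset.mem_sdiff, Finset.mem_filter] at this ⊢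
    tauto
  have hdisj : Disjoint ((dots n S n).filter (fun x => matchCol n S x = x)) (LSet n S \ X) := by
    rw [Finset.disjoint_left]
    intro x hx hx'
    exact (mem_LSet.1 (Finset.sdiff_subset hx')).2 (Finset.mem_filter.1 hx).2
  rw [Finset.prod_union (disjoint_image hX), Finset.prod_image (matchCol_injOn.mono hX), hD,
    Finset.prod_union hdisj, Finset.prod_mul_distrib, Finset.prod_const]
  ring

end Exchange

/-- The ideal of elements annihilated by sandwiching between `P` and `N`. -/
def sandwichIdeal {R W B : Type} [CommSemiring R] [CommRing W] [Algebra R W] [Semiring B]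
    [Algebra R B] (φ : W →ₐ[R] B) (P N : B) : Ideal W where
  carrier := {p | ∀ r, P * φ (p * r) * N = 0}
  add_mem' {a b} ha hb r := by rw [add_mul, map_add, mul_add, add_mul, ha r, hb r, add_zero]
  zero_mem' r := by simp
  smul_mem' c x hx r := by rw [smul_eq_mul, mul_comm c, mul_assoc x c r]; exact hx _

theorem sandwich_eq_of_mk_eq {R W B : Type} [CommSemiring R] [CommRing W] [Algebra R W] [Semiring B]
    [Algebra R B] {φ : W →ₐ[R] B} {P N : B} {a b : W}
    (h : Ideal.Quotient.mk (sandwichIdeal φ P N) a = Ideal.Quotient.mk (sandwichIdeal φ P N) b) :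
    P * φ a * N = P * φ b * N := by
  have h1 := (Ideal.Quotient.eq.1 h) 1
  rw [mul_one] at h1
  rw [← sub_add_cancel a b, map_add, mul_add, add_mul, h1, zero_add]

section Twisted

variable {n : ℕ} {S : Finset ℤ} {W : Type} [CommRing W] [Algebra AL W] {φ : W →ₐ[AL] LamAlg n}
  {w : ℤ → W}

/-- The tail sums rescaled by one factor `-q⁻¹` for each column from `c` on carrying exactly
one dot. -/
def twistedTail (n : ℕ) (S : Finset ℤ) (w : ℤ → W) (c : ℤ) : W :=
  (-qAinv) ^ singleCount n S ((n : ℤ) + 1 - c).toNat • tailSum n w c.toNat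

theorem singleCount_succ_of_iff {k : ℕ} (h : (n : ℤ) - k ∈ S ↔ -((n : ℤ) - k) ∈ S) :
    singleCount n S (k + 1) = singleCount n S k := by
  rw [singleCount, singleCount, posCount, negCount, if_neg (by tauto), if_neg (by tauto),
    zero_add, zero_add]

theorem singleCount_succ_of_not_iff {k : ℕ} (h : ¬ ((n : ℤ) - k ∈ S ↔ -((n : ℤ) - k) ∈ S)) :
    singleCount n S (k + 1) = singleCount n S k + 1 := by
  rw [singleCount, singleCount, posCount, negCount]
  by_cases h1 : (n : ℤ) - k ∈ S
  · rw [if_pos (by tauto), if_neg (by tauto)]; omega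
  · rw [if_neg (by tauto), if_pos (by tauto)]; omega

theorem exists_col {c : ℤ} (hc : 0 < c) (hcn : c ≤ n) :
    ∃ k : ℕ, ∃ i : ℕ, c = (n : ℤ) - k ∧ c = i ∧ i + k = n ∧ 1 ≤ i :=
  ⟨n - c.toNat, c.toNat, by omega, by omega, by omega, by omega⟩

theorem twistedTail_last : twistedTail n S w (n + 1) = 0 := by
  have h : ((n : ℤ) + 1).toNat = n + 1 := by omega
  rw [twistedTail, h, tailSum_last, smul_zero]

theorem twistedTail_col {k i : ℕ} (h : i + k = n) :
    twistedTail n S w i = (-qAinv) ^ singleCount n S (k + 1) • tailSum n w i ∧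
    twistedTail n S w (i + 1) = (-qAinv) ^ singleCount n S k • tailSum n w (i + 1) := by
  have h1 : ((n : ℤ) + 1 - i).toNat = k + 1 := by omega
  have h2 : ((n : ℤ) + 1 - (i + 1)).toNat = k := by omega
  have h3 : ((i : ℤ) + 1).toNat = i + 1 := by omega
  rw [twistedTail, twistedTail, h1, h2, h3, Int.toNat_natCast]
  exact ⟨rfl, rfl⟩

theorem twist_smul_eq {c : ℤ} (hc : 0 < c) (hcn : c ≤ n) (h : c ∈ S ↔ -c ∈ S) :
    twist n S c • w c = twistedTail n S w c + qA • twistedTail n S w (c + 1) := by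
  obtain ⟨k, i, rfl, h1, hik, hi⟩ := exists_col hc hcn
  rw [twist_col, h1, (twistedTail_col hik).1, (twistedTail_col hik).2, singleCount_succ_of_iff h,
    smul_comm qA, ← smul_add, ← eq_tailSum_add w (by omega)]

theorem twist_smul_neg_eq (hφ : Function.Injective φ) (hw : ∀ c, φ (w c) = wa n c) {c : ℤ}
    (hc : 0 < c) (hcn : c ≤ n) (h : c ∈ S ↔ -c ∈ S) :
    (twist n S c * (-qAinv ^ 2)) • w (-c) =
      twistedTail n S w c + qAinv • twistedTail n S w (c + 1) := by
  obtain ⟨k, i, rfl, h1, hik, hi⟩ := exists_col hc hcn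
  have hs : (-qAinv ^ 2) * (-qA ^ 2) = 1 := by
    linear_combination (qA * qAinv + 1) * qA_mul_qAinv
  rw [twist_col, h1, (twistedTail_col hik).1, (twistedTail_col hik).2, singleCount_succ_of_iff h,
    smul_comm qAinv, ← smul_add, neg_eq_tailSum_add hφ hw hi (by omega), smul_smul, mul_assoc, hs,
    mul_one]

theorem w_mem_sandwichIdeal (hw : ∀ c, φ (w c) = wa n c) {c : ℤ} (hc : 0 < c) (hcn : c ≤ n)
    (h : ¬ (c ∈ S ↔ -c ∈ S)) : w c ∈ sandwichIdeal φ (posFactor n S n) (negFactor n S n) := by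
  intro r
  by_cases h1 : c ∈ S
  · rw [map_mul, hw, ← mul_assoc, posFactor_mul_wa h1 (by tauto) le_rfl (by omega) hcn, zero_mul,
      zero_mul]
  · rw [mul_comm, map_mul, hw, mul_assoc, mul_assoc,
      wa_mul_negFactor h1 (by tauto) le_rfl (by omega) hcn, mul_zero, mul_zero]

theorem twistedTail_single (hw : ∀ c, φ (w c) = wa n c) {c : ℤ} (hc : 0 < c) (hcn : c ≤ n)
    (h : ¬ (c ∈ S ↔ -c ∈ S)) :
    twistedTail n S w c - twistedTail n S w (c + 1) ∈
      sandwichIdeal φ (posFactor n S n) (negFactor n S n) := by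
  have hmem := w_mem_sandwichIdeal hw hc hcn h
  obtain ⟨k, i, rfl, h1, hik, hi⟩ := exists_col hc hcn
  have h2 : twistedTail n S w i - twistedTail n S w (i + 1) =
      (-qAinv) ^ singleCount n S (k + 1) • w i := by
    rw [(twistedTail_col hik).1, (twistedTail_col hik).2, singleCount_succ_of_not_iff h,
      eq_tailSum_add (n := n) w (c := i) (by omega), smul_add, smul_smul, sub_eq_add_neg, ← neg_smul]
    congr 2
    rw [pow_succ]
    linear_combination (-qAinv) ^ singleCount n S k * qA_mul_qAinv
  rw [h1] at hmem ⊢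
  rw [h2, Algebra.smul_def]
  exact Ideal.mul_mem_left _ _ hmem

theorem sum_exchange_invariant (hφ : Function.Injective φ) (hw : ∀ c, φ (w c) = wa n c) :
    posFactor n S n * φ (∑ X ∈ (LSet n S).powerset, qAinv ^ X.card •
        ∏ c ∈ (dots n S n \ X) ∪ X.image (matchCol n S), twist n S c • w c) * negFactor n S n =
    posFactor n S n * φ (∑ X ∈ (LSet n S).powerset, qA ^ X.card •
        ∏ c ∈ (dots n S n \ X) ∪ X.image (matchCol n S),
          (twist n S c * (-qAinv ^ 2)) • w (-c)) * negFactor n S n := by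
  apply sandwich_eq_of_mk_eq
  set mk := Ideal.Quotient.mk (sandwichIdeal φ (posFactor n S n) (negFactor n S n)) with hmk
  set y : ℤ → _ := fun c => mk (twistedTail n S w c)
  set q := mk (algebraMap AL W qA)
  set q' := mk (algebraMap AL W qAinv)
  have hq : q * q' = 1 := by rw [← map_mul, ← map_mul, qA_mul_qAinv, map_one, map_one]
  have e1 : ∀ c : ℤ, 0 < c → c ≤ n → (c ∈ S ↔ -c ∈ S) →
      mk (twist n S c • w c) = y c + q * y (c + 1) := fun c hc hcn h => by
    rw [twist_smul_eq hc hcn h, map_add, Algebra.smul_def, map_mul]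
  have e2 : ∀ c : ℤ, 0 < c → c ≤ n → (c ∈ S ↔ -c ∈ S) →
      mk ((twist n S c * (-qAinv ^ 2)) • w (-c)) = y c + q' * y (c + 1) := fun c hc hcn h => by
    rw [twist_smul_neg_eq hφ hw hc hcn h, map_add, Algebra.smul_def, map_mul]
  have key := (prod_pairFactor_chain (S := S) y hq (by simp [y, twistedTail_last])
    (fun c hc hcn h => Ideal.Quotient.eq.2 (twistedTail_single hw hc hcn h))
    (fun c hc hcn h => by
      have h0 : w c * w (-c) = 0 := hφ (by rw [map_mul, hw, hw, wa_mul_wa_neg, map_zero])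
      rw [← e1 c hc hcn h, ← e2 c hc hcn h, ← map_mul, smul_mul_smul_comm, h0, smul_zero,
        map_zero]) le_rfl).1
  have reduce : ∀ (r : AL) (t t' : _) (g : ℤ → W), mk (algebraMap AL W r) = t' →
      (∀ c : ℤ, 0 < c → c ≤ n → (c ∈ S ↔ -c ∈ S) → mk (g c) = y c + t * y (c + 1)) →
      mk (∑ X ∈ (LSet n S).powerset, r ^ X.card •
        ∏ c ∈ (dots n S n \ X) ∪ X.image (matchCol n S), g c) =
      ∏ x ∈ dots n S n, pairFactor y t t' (matchState n S n).1 x := by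
    intro r t t' g ht' hg
    simp only [Algebra.smul_def, map_pow]
    rw [sum_exchange, map_prod]
    refine Finset.prod_congr rfl fun x hx => ?_
    obtain ⟨hx1, hx2, hx3, hx4⟩ := mem_dots_self.1 hx
    have hgx := hg x hx1 hx2 (by tauto)
    rw [pairFactor, ← matchCol_eq]
    split_ifs with h
    · exact hgx
    · have hf := matchCol_free (mem_LSet.2 ⟨hx, h⟩)
      rw [map_add, map_mul, hgx, hg _ hf.1 hf.2.1 (by tauto), ht']
  rw [reduce qAinv q q' _ rfl e1, reduce qA q' q _ rfl e2, key]

theorem smul_vset_exchange (hw : ∀ c, φ (w c) = wa n c) (hS : S ⊆ Iset n) {X : Finset ℤ}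
    (hX : X ⊆ LSet n S) :
    vset n ((S \ pmSet X) ∪ pmSet (X.image (matchCol n S))) =
      qAinv ^ ((dots n S n).card * ((dots n S n).card - 1)) • (posFactor n S n *
        φ (∏ c ∈ (dots n S n \ X) ∪ X.image (matchCol n S), twist n S c • w c) *
          negFactor n S n) ∧
    barScalar ((S \ pmSet X) ∪ pmSet (X.image (matchCol n S))) •
        vsetRev n ((S \ pmSet X) ∪ pmSet (X.image (matchCol n S))) =
      qAinv ^ ((dots n S n).card * ((dots n S n).card - 1)) • (posFactor n S n *
        φ (∏ c ∈ (dots n S n \ X) ∪ X.image (matchCol n S),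
          (twist n S c * (-qAinv ^ 2)) • w (-c)) * negFactor n S n) := by
  have hS' := exchange_subset hS hX
  have hp := fun {k : ℕ} (hk : k ≤ n) =>
    posFactor_congr (fun c hc _ => (exchange_single_iff hX hc).1) hk
  have hn := fun {k : ℕ} (hk : k ≤ n) =>
    negFactor_congr (fun c hc _ => (exchange_single_iff hX hc).2) hk
  have h1 := vset_upper φ hw hS' le_rfl
  have h2 := vsetRev_upper φ hw hS' le_rfl
  have ht : ∀ c ∈ (dots n S n \ X) ∪ X.image (matchCol n S),
      twist n ((S \ pmSet X) ∪ pmSet (X.image (matchCol n S))) c = twist n S c := fun c hc => by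
    have hc : 0 < c := by
      rcases Finset.mem_union.1 hc with hc | hc
      · exact (mem_dots_self.1 (Finset.sdiff_subset hc)).1
      · exact (free_of_mem_image hX hc).1
    have hk : ((n : ℤ) - c).toNat ≤ n := by omega
    rw [twist, twist, singleCount, singleCount, (hp hk).2, (hn hk).2]
  rw [← barScalar_eq hS'] at h2
  rw [upper_self hS', dots_exchange hX, card_exchange hX, ← (hp le_rfl).1, ← (hn le_rfl).1]
    at h1 h2
  rw [h1, h2]
  constructor
  · rw [Finset.prod_congr rfl fun c hc => by rw [ht c hc]]
  · rw [Finset.prod_congr rfl fun c hc => by rw [ht c hc]]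

end Twisted

/-- each canonical basis vector b_S is invariant under the bar map. -/
theorem stmt19 (n : ℕ) (hn : 1 ≤ n) (bar : LamAlg n →+ LamAlg n)
    (hbar1 : ∀ (g : AL) (x : LamAlg n), bar (g • x) = (LaurentPolynomial.invert g) • bar x)
    (hbar2 : ∀ S : Finset ℤ, S ⊆ Iset n → bar (vset n S) = barScalar S • vsetRev n S) :
    ∀ S : Finset ℤ, S ⊆ Iset n → bar (bSvec n S) = bSvec n S := by
  intro S hS
  obtain ⟨W, _, _, φ, w, hφ, hw⟩ := exists_commRing_of_commute (R := AL) (wa n) (wa_comm n)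
  have key := sum_exchange_invariant (S := S) hφ hw
  have e1 : bSvec n S = qAinv ^ ((dots n S n).card * ((dots n S n).card - 1)) •
      (posFactor n S n * φ (∑ X ∈ (LSet n S).powerset, qAinv ^ X.card •
        ∏ c ∈ (dots n S n \ X) ∪ X.image (matchCol n S), twist n S c • w c) *
        negFactor n S n) := by
    rw [bSvec, map_sum, Finset.mul_sum, Finset.sum_mul, Finset.smul_sum]
    refine Finset.sum_congr rfl fun X hX => ?_
    rw [(smul_vset_exchange hw hS (Finset.mem_powerset.1 hX)).1, map_smul, mul_smul_comm,
      smul_mul_assoc, smul_comm, qAinv, LaurentPolynomial.T_pow _ X.card, mul_neg_one]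
  have e2 : bar (bSvec n S) = qAinv ^ ((dots n S n).card * ((dots n S n).card - 1)) •
      (posFactor n S n * φ (∑ X ∈ (LSet n S).powerset, qA ^ X.card •
        ∏ c ∈ (dots n S n \ X) ∪ X.image (matchCol n S),
          (twist n S c * (-qAinv ^ 2)) • w (-c)) * negFactor n S n) := by
    rw [bSvec, map_sum, map_sum, Finset.mul_sum, Finset.sum_mul, Finset.smul_sum]
    refine Finset.sum_congr rfl fun X hX => ?_
    rw [Finset.mem_powerset] at hX
    rw [hbar1, hbar2 _ (exchange_subset hS hX), (smul_vset_exchange hw hS hX).2, map_smul,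
      mul_smul_comm, smul_mul_assoc, smul_comm, LaurentPolynomial.invert_T, neg_neg, qA,
      LaurentPolynomial.T_pow, mul_one]
  rw [e2, e1, key]

end
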